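/- arXiv:0708.2777 — 8 statements merged into one kernel-verified Lean document; each statement's English description precedes it below -/
import Mathlib

section
/- The map d̄₁ is a metric on 𝔑 bounded by 1: for all ξ, η, ζ ∈ 𝔑 one has 0 ≤ d̄₁(ξ,η) ≤ 1, d̄₁(ξ,η) = 0 if and only if ξ = η, d̄₁(ξ,η) = d̄₁(η,ξ), and d̄₁(ξ,η) ≤ d̄₁(ξ,ζ) + d̄₁(ζ,η). -/
open scoped BigOperators

/-- The minimal total `d`-cost of matching the points of `ξ` with points of `η`
(only `min(|ξ|,|η|)` points are matched, namely the initial segments of two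
suitably ordered lists representing the two point measures). -/
noncomputable def matchCost {S : Type*} (d : S → S → ℝ) (ξ η : Multiset S) : ℝ :=
  sInf {c : ℝ | ∃ xs ys : List S, (xs : Multiset S) = ξ ∧ (ys : Multiset S) = η ∧
    c = (List.zipWith d xs ys).sum}

open scoped Classical in
/-- The metric `d̄₁` between finite point measures: for `|ξ| = m ≤ n = |η|`, `n ≥ 1`,
`d̄₁(ξ,η) = (1/n) (min_π Σ_{i=1}^m d(x_i, y_{π(i)}) + (n - m))`, and `d̄₁(0,0) = 0`. -/
noncomputable def dbar1 {S : Type*} (d : S → S → ℝ) (ξ η : Multiset S) : ℝ :=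
  if ξ = 0 ∧ η = 0 then 0
  else (matchCost d ξ η + (((max ξ.card η.card : ℕ) : ℝ) - ((min ξ.card η.card : ℕ) : ℝ)))
        / ((max ξ.card η.card : ℕ) : ℝ)

/-- `w` matches some of the points of `ξ` injectively with some of the points of `η`. -/
def IsPartialMatching {S : Type*} (ξ η : Multiset S) (w : Multiset (S × S)) : Prop :=
  w.map Prod.fst ≤ ξ ∧ w.map Prod.snd ≤ η

/-- The amount by which `w` improves on leaving all points unmatched at unit cost. -/
noncomputable def matchGain {S : Type*} (d : S → S → ℝ) (w : Multiset (S × S)) : ℝ :=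
  (w.map fun p => 1 - d p.1 p.2).sum

section MatchGain

variable {S : Type*} {d : S → S → ℝ}

theorem matchGain_cons (p : S × S) (w : Multiset (S × S)) :
    matchGain d (p ::ₘ w) = (1 - d p.1 p.2) + matchGain d w := by
  simp [matchGain]

theorem matchGain_eq_card_sub (w : Multiset (S × S)) :
    matchGain d w = w.card - (w.map fun p => d p.1 p.2).sum := by
  simp [matchGain, Multiset.sum_map_sub]

theorem matchGain_nonneg (hd : ∀ x y, d x y ≤ 1) (w : Multiset (S × S)) :
    0 ≤ matchGain d w := by
  refine Multiset.sum_nonneg fun r hr => ?_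
  obtain ⟨p, -, rfl⟩ := Multiset.mem_map.1 hr
  linarith [hd p.1 p.2]

theorem matchGain_le_card (hd0 : ∀ x y, 0 ≤ d x y) (w : Multiset (S × S)) :
    matchGain d w ≤ w.card := by
  rw [matchGain_eq_card_sub]
  have : 0 ≤ (w.map fun p => d p.1 p.2).sum := by
    refine Multiset.sum_nonneg fun r hr => ?_
    obtain ⟨p, -, rfl⟩ := Multiset.mem_map.1 hr
    exact hd0 _ _
  linarith

theorem matchGain_map_swap (hsymm : ∀ x y, d x y = d y x) (w : Multiset (S × S)) :
    matchGain d (w.map Prod.swap) = matchGain d w := by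
  simp [matchGain, Multiset.map_map, hsymm]

theorem IsPartialMatching.swap {ξ η : Multiset S} {w : Multiset (S × S)}
    (h : IsPartialMatching ξ η w) : IsPartialMatching η ξ (w.map Prod.swap) := by
  simpa [IsPartialMatching, Multiset.map_map, Function.comp_def, and_comm] using h

theorem IsPartialMatching.card_le_min {ξ η : Multiset S} {w : Multiset (S × S)}
    (h : IsPartialMatching ξ η w) : w.card ≤ min ξ.card η.card :=
  le_min (by simpa using Multiset.card_le_card h.1) (by simpa using Multiset.card_le_card h.2)

theorem exists_cons_of_map_le_cons {T : Type*} {f : T → S} {w : Multiset T} {z : S}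
    {ζ : Multiset S} (h : w.map f ≤ z ::ₘ ζ) :
    w.map f ≤ ζ ∨ ∃ p w', w = p ::ₘ w' ∧ f p = z ∧ w'.map f ≤ ζ := by
  by_cases hz : z ∈ w.map f
  · obtain ⟨p, hp, rfl⟩ := Multiset.mem_map.1 hz
    obtain ⟨w', rfl⟩ := Multiset.exists_cons_of_mem hp
    rw [Multiset.map_cons] at h
    exact Or.inr ⟨p, w', rfl, rfl, (Multiset.cons_le_cons_iff _).1 h⟩
  · exact Or.inl ((Multiset.le_cons_of_notMem hz).1 h)

/-- Composition of partial matchings along a common intermediate point measure `ζ`. -/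
theorem exists_comp_matchGain (hd0 : ∀ x y, 0 ≤ d x y)
    (htri : ∀ x y z, d x z ≤ d x y + d y z) (ζ : Multiset S) :
    ∀ w₁ w₂ : Multiset (S × S), w₁.map Prod.snd ≤ ζ → w₂.map Prod.fst ≤ ζ →
      ∃ w, IsPartialMatching (w₁.map Prod.fst) (w₂.map Prod.snd) w ∧
        matchGain d w₁ + matchGain d w₂ ≤ matchGain d w + ζ.card := by
  induction ζ using Multiset.induction_on with
  | empty =>
    intro w₁ w₂ h₁ h₂
    simp only [Multiset.le_zero, Multiset.map_eq_zero] at h₁ h₂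
    subst h₁ h₂
    exact ⟨0, by simp [IsPartialMatching, matchGain]⟩
  | cons z ζ ih =>
    intro w₁ w₂ h₁ h₂
    rw [Multiset.card_cons]
    push_cast
    rcases exists_cons_of_map_le_cons h₁ with h₁' | ⟨⟨x, z₁⟩, w₁, rfl, rfl, h₁'⟩ <;>
    rcases exists_cons_of_map_le_cons h₂ with h₂' | ⟨⟨z₂, y⟩, w₂, rfl, hz, h₂'⟩ <;>
    obtain ⟨w, hw, hle⟩ := ih _ _ h₁' h₂'
    · exact ⟨w, hw, by linarith⟩
    · refine ⟨w, ⟨hw.1, hw.2.trans ?_⟩, ?_⟩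
      · simpa using Multiset.le_cons_self _ _
      · rw [matchGain_cons]
        linarith [hd0 (z₂, y).1 (z₂, y).2]
    · refine ⟨w, ⟨hw.1.trans ?_, hw.2⟩, ?_⟩
      · simpa using Multiset.le_cons_self _ _
      · rw [matchGain_cons]
        linarith [hd0 (x, z₁).1 (x, z₁).2]
    · dsimp only at hz
      subst hz
      refine ⟨(x, y) ::ₘ w, ⟨?_, ?_⟩, ?_⟩
      · simpa using hw.1
      · simpa using hw.2
      · simp only [matchGain_cons]
        linarith [htri x z₂ y]

theorem finite_matchCost_set (d : S → S → ℝ) (ξ η : Multiset S) :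
    {c : ℝ | ∃ xs ys : List S, (xs : Multiset S) = ξ ∧ (ys : Multiset S) = η ∧
      c = (List.zipWith d xs ys).sum}.Finite := by
  have hfin : ∀ μ : Multiset S, {l : List S | (l : Multiset S) = μ}.Finite := fun μ => by
    induction μ using Quotient.inductionOn with
    | h l₀ =>
      refine (l₀.permutations.finite_toSet).subset fun l hl => ?_
      exact List.mem_permutations.2 (Multiset.coe_eq_coe.1 hl)
  refine (((hfin ξ).prod (hfin η)).image fun p => (List.zipWith d p.1 p.2).sum).subset ?_
  rintro c ⟨xs, ys, hx, hy, rfl⟩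
  exact ⟨(xs, ys), ⟨hx, hy⟩, rfl⟩

theorem exists_lists_matchCost (d : S → S → ℝ) (ξ η : Multiset S) :
    ∃ xs ys : List S, (xs : Multiset S) = ξ ∧ (ys : Multiset S) = η ∧
      matchCost d ξ η = (List.zipWith d xs ys).sum := by
  have hne : {c : ℝ | ∃ xs ys : List S, (xs : Multiset S) = ξ ∧ (ys : Multiset S) = η ∧
      c = (List.zipWith d xs ys).sum}.Nonempty :=
    ⟨_, ξ.toList, η.toList, ξ.coe_toList, η.coe_toList, rfl⟩
  exact hne.csInf_mem (finite_matchCost_set d ξ η)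

theorem matchCost_le (d : S → S → ℝ) (xs ys : List S) :
    matchCost d (xs : Multiset S) (ys : Multiset S) ≤ (List.zipWith d xs ys).sum :=
  csInf_le (finite_matchCost_set d _ _).bddBelow ⟨xs, ys, rfl, rfl, rfl⟩

theorem sum_zipWith_le (hd : ∀ x y, d x y ≤ 1) (xs ys : List S) :
    (List.zipWith d xs ys).sum ≤ (min xs.length ys.length : ℕ) := by
  have h := List.sum_le_card_nsmul (List.zipWith d xs ys) 1 fun r hr => by
    rw [← List.map_uncurry_zip_eq_zipWith] at hr
    obtain ⟨p, -, rfl⟩ := List.mem_map.1 hr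
    exact hd _ _
  simpa using h

/-- The largest gain of a partial matching determines the matching cost. -/
theorem isGreatest_matchGain (hd : ∀ x y, d x y ≤ 1) (ξ η : Multiset S) :
    IsGreatest (Set.image (matchGain d) {w | IsPartialMatching ξ η w})
      ((min ξ.card η.card : ℕ) - matchCost d ξ η) := by
  constructor
  · obtain ⟨xs, ys, rfl, rfl, h⟩ := exists_lists_matchCost d ξ η
    refine ⟨(xs.zip ys : List (S × S)), ⟨?_, ?_⟩, ?_⟩
    · rw [Multiset.map_coe, Multiset.coe_le, List.zip_eq_zip_take_min,
        List.map_fst_zip (by simp)]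
      exact (List.take_sublist _ _).subperm
    · rw [Multiset.map_coe, Multiset.coe_le, List.zip_eq_zip_take_min,
        List.map_snd_zip (by simp)]
      exact (List.take_sublist _ _).subperm
    · rw [matchGain_eq_card_sub, h, ← List.map_uncurry_zip_eq_zipWith]
      simp [Function.uncurry_def]
  · rintro _ ⟨w, ⟨h₁, h₂⟩, rfl⟩
    obtain ⟨ξ', rfl⟩ := Multiset.le_iff_exists_add.1 h₁
    obtain ⟨η', rfl⟩ := Multiset.le_iff_exists_add.1 h₂
    induction w using Quotient.inductionOn with | h l => ?_
    induction ξ' using Quotient.inductionOn with | h as => ?_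
    induction η' using Quotient.inductionOn with | h bs => ?_
    have hle := matchCost_le d (l.map Prod.fst ++ as) (l.map Prod.snd ++ bs)
    rw [List.zipWith_append (by simp), List.sum_append, List.zipWith_map,
      List.zipWith_self] at hle
    have hrest := sum_zipWith_le hd as bs
    simp only [Multiset.quot_mk_to_coe, matchGain_eq_card_sub, Multiset.map_coe, Multiset.coe_add,
      Multiset.coe_card,
      Multiset.sum_coe, List.length_append, List.length_map] at hle ⊢
    push_cast at hle hrest ⊢
    rw [min_add_add_left]
    linarith

theorem dbar1_eq (d : S → S → ℝ) (ξ η : Multiset S) :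
    dbar1 d ξ η = ((max ξ.card η.card : ℕ) - ((min ξ.card η.card : ℕ) - matchCost d ξ η)) /
      (max ξ.card η.card : ℕ) := by
  unfold dbar1
  split_ifs with h
  · simp [h.1, h.2]
  · congr 1
    ring

end MatchGain

theorem eq_of_matchGain_eq_max {S : Type*} [MetricSpace S] {ξ η : Multiset S}
    {w : Multiset (S × S)} (hw : IsPartialMatching ξ η w)
    (h : matchGain dist w = (max ξ.card η.card : ℕ)) : ξ = η := by
  have hcard : max ξ.card η.card ≤ w.card := by
    exact_mod_cast h ▸ matchGain_le_card (d := dist) (fun _ _ => dist_nonneg) w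
  have hmin := hw.card_le_min
  have h₁ : w.map Prod.fst = ξ := Multiset.eq_of_le_of_card_le hw.1 (by simp; omega)
  have h₂ : w.map Prod.snd = η := Multiset.eq_of_le_of_card_le hw.2 (by simp; omega)
  have hcard_eq : w.card = max ξ.card η.card := by omega
  rw [matchGain_eq_card_sub, hcard_eq] at h
  rw [← h₁, ← h₂]
  refine Multiset.map_congr rfl fun p hp => dist_eq_zero.1 (le_antisymm ?_ dist_nonneg)
  have hle := Multiset.single_le_sum (s := w.map fun p => dist p.1 p.2)
    (fun r hr => by
      obtain ⟨q, -, rfl⟩ := Multiset.mem_map.1 hr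
      exact dist_nonneg) _ (Multiset.mem_map_of_mem _ hp)
  linarith

/-- The triangle inequality for costs `max - G` normalised by `max`, given that the gains `G`
compose with a loss of at most the size `k` of the intermediate point measure. -/
theorem normalized_gain_triangle {m n k G G₁ G₂ : ℝ} (hm : 0 ≤ m) (hk : 0 ≤ k)
    (hG : 0 ≤ G) (hG₁ : 0 ≤ G₁) (hG₂ : 0 ≤ G₂) (hle₁ : G₁ ≤ min m k) (hle₂ : G₂ ≤ min k n)
    (h : G₁ + G₂ ≤ G + k) :
    (max m n - G) / max m n ≤ (max m k - G₁) / max m k + (max k n - G₂) / max k n := by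
  have hmono : ∀ {D A B : ℝ}, 0 ≤ D → D ≤ A → A ≤ B → D / B ≤ D / A := by
    intro D A B hD hDA hAB
    rcases hD.eq_or_lt with rfl | hD
    · simp
    · exact div_le_div_of_nonneg_left hD.le (hD.trans_le hDA) hAB
  have hmm₁ : min m k ≤ max m k := min_le_max
  have hmm₂ : min k n ≤ max k n := min_le_max
  rcases le_or_gt k (max m n) with hkM | hkM
  · refine le_trans ?_ (add_le_add
      (hmono (B := max m n) (by linarith) (by linarith) (max_le (le_max_left _ _) hkM))
      (hmono (B := max m n) (by linarith) (by linarith) (max_le hkM (le_max_right _ _))))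
    rw [← add_div]
    refine div_le_div_of_nonneg_right ?_ (hm.trans (le_max_left _ _))
    have : max m n + k ≤ max m k + max k n := by
      rcases max_cases m n with ⟨e, -⟩ | ⟨e, -⟩ <;> rw [e] <;>
        linarith [le_max_left m k, le_max_right m k, le_max_left k n, le_max_right k n]
    linarith
  · obtain ⟨hmk, hnk⟩ := max_lt_iff.1 hkM
    have hkpos : 0 < k := hm.trans_lt hmk
    rw [max_eq_right hmk.le, max_eq_left hnk.le, ← add_div]
    rcases (hm.trans (le_max_left m n)).eq_or_lt with h0 | hM
    · rw [← h0, div_zero]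
      rw [max_eq_right hmk.le] at hmm₁
      rw [max_eq_left hnk.le] at hmm₂
      exact div_nonneg (by linarith) hk
    · rw [div_le_div_iff₀ hM hkpos]
      nlinarith [mul_nonneg hG (sub_nonneg.2 hkM.le), mul_le_mul_of_nonneg_left h hM.le]

/-- `d̄₁` is a metric on the space of finite point measures, bounded by 1. -/
theorem dbar1_is_metric_bounded_by_one {S : Type*} [MetricSpace S] [CompactSpace S]
    (hd : ∀ x y : S, dist x y ≤ 1) (ξ η ζ : Multiset S) :
    0 ≤ dbar1 dist ξ η ∧
    dbar1 dist ξ η ≤ 1 ∧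
    (dbar1 dist ξ η = 0 ↔ ξ = η) ∧
    dbar1 dist ξ η = dbar1 dist η ξ ∧
    dbar1 dist ξ η ≤ dbar1 dist ξ ζ + dbar1 dist ζ η := by
  have hgain : ∀ μ ν : Multiset S, ∃ G : ℝ,
      IsGreatest (Set.image (matchGain dist) {w | IsPartialMatching μ ν w}) G ∧
      dbar1 dist μ ν = (max (μ.card : ℝ) ν.card - G) / max (μ.card : ℝ) ν.card ∧
      0 ≤ G ∧ G ≤ min (μ.card : ℝ) ν.card := by
    intro μ ν
    have hgr := isGreatest_matchGain hd μ ν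
    refine ⟨_, hgr, by rw [dbar1_eq, Nat.cast_max], ?_⟩
    obtain ⟨w, hw, hwG⟩ := hgr.1
    rw [← hwG]
    refine ⟨matchGain_nonneg hd w, (matchGain_le_card (fun _ _ => dist_nonneg) w).trans ?_⟩
    exact_mod_cast hw.card_le_min
  obtain ⟨G, hgr, hD, hG0, hGle⟩ := hgain ξ η
  have hGmax : G ≤ max (ξ.card : ℝ) η.card := hGle.trans min_le_max
  have hmax : 0 ≤ max (ξ.card : ℝ) η.card := hG0.trans hGmax
  refine ⟨?_, ?_, ⟨fun h => ?_, ?_⟩, ?_, ?_⟩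
  · rw [hD]
    exact div_nonneg (by linarith) hmax
  · rw [hD]
    exact div_le_one_of_le₀ (by linarith) hmax
  · have hGeq : G = max (ξ.card : ℝ) η.card := by
      rw [hD, div_eq_zero_iff] at h
      rcases h with h | h <;> linarith
    obtain ⟨w, hw, rfl⟩ := hgr.1
    exact eq_of_matchGain_eq_max hw (by rw [hGeq, Nat.cast_max])
  · rintro rfl
    have hle := hgr.2 ⟨ξ.map fun x => (x, x), by simp [IsPartialMatching], rfl⟩
    rw [matchGain_eq_card_sub] at hle
    simp only [Multiset.map_map, Function.comp_def, dist_self, Multiset.card_map,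
      Multiset.map_const', Multiset.sum_replicate, smul_zero, sub_zero] at hle
    rw [max_self] at hGmax
    rw [hD, max_self, le_antisymm hGmax hle, sub_self, zero_div]
  · obtain ⟨G', hgr', hD', -⟩ := hgain η ξ
    have hswap : ∀ {μ ν : Multiset S} {A B : ℝ},
        IsGreatest (Set.image (matchGain dist) {w | IsPartialMatching μ ν w}) A →
        IsGreatest (Set.image (matchGain dist) {w | IsPartialMatching ν μ w}) B → A ≤ B := by
      intro μ ν A B hA hB
      obtain ⟨w, hw, rfl⟩ := hA.1
      exact hB.2 ⟨_, hw.swap, matchGain_map_swap dist_comm w⟩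
    rw [hD, hD', max_comm, le_antisymm (hswap hgr hgr') (hswap hgr' hgr)]
  · obtain ⟨G₁, hgr₁, hD₁, hG₁, hle₁⟩ := hgain ξ ζ
    obtain ⟨G₂, hgr₂, hD₂, hG₂, hle₂⟩ := hgain ζ η
    rw [hD, hD₁, hD₂]
    refine normalized_gain_triangle (Nat.cast_nonneg _) (Nat.cast_nonneg _) hG0 hG₁ hG₂ hle₁ hle₂ ?_
    obtain ⟨w₁, hw₁, rfl⟩ := hgr₁.1
    obtain ⟨w₂, hw₂, rfl⟩ := hgr₂.1
    obtain ⟨w, hw, hle⟩ := exists_comp_matchGain (d := dist) (fun _ _ => dist_nonneg)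
      dist_triangle ζ w₁ w₂ hw₁.2 hw₂.1
    have := hgr.2 ⟨w, ⟨hw.1.trans hw₁.1, hw.2.trans hw₂.2⟩, rfl⟩
    linarith
end

section
/- The metric d̄₁ metrizes the same topology on 𝔑 as d₁: for any sequence (ξ_k) in 𝔑 and any ξ ∈ 𝔑, d̄₁(ξ_k, ξ) → 0 as k → ∞ if and only if d₁(ξ_k, ξ) → 0 as k → ∞. -/
open scoped BigOperators

open scoped Classical in
/-- The metric `d₁` of Barbour and Brown: `d₁(ξ,η) = min_π (1/n) Σ_{i=1}^n d(x_i,y_{π(i)})`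
if `|ξ| = |η| = n ≥ 1`, `d₁(ξ,η) = 1` if `|ξ| ≠ |η|`, and `d₁(0,0) = 0`. -/
noncomputable def d1 {S : Type*} (d : S → S → ℝ) (ξ η : Multiset S) : ℝ :=
  if ξ.card = η.card then (if ξ = 0 then 0 else matchCost d ξ η / (ξ.card : ℝ)) else 1

theorem matchCost_nonneg {S : Type*} {d : S → S → ℝ} (hd : ∀ x y, 0 ≤ d x y)
    (ξ η : Multiset S) : 0 ≤ matchCost d ξ η := by
  refine Real.sInf_nonneg ?_
  rintro c ⟨xs, ys, -, -, rfl⟩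
  refine List.sum_nonneg fun a ha => ?_
  rw [← List.map_uncurry_zip_eq_zipWith, List.mem_map] at ha
  obtain ⟨p, -, rfl⟩ := ha
  exact hd p.1 p.2

theorem dbar1_eq_d1_of_card_eq {S : Type*} (d : S → S → ℝ) {ξ η : Multiset S}
    (h : ξ.card = η.card) : dbar1 d ξ η = d1 d ξ η := by
  have h0 : ξ = 0 ↔ η = 0 := by rw [← Multiset.card_eq_zero, ← Multiset.card_eq_zero, h]
  by_cases hη : η = 0
  · simp [dbar1, d1, hη, h0.2 hη]
  · simp [dbar1, d1, h, hη, mt h0.1 hη]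

theorem inv_card_add_one_le_dbar1 {S : Type*} {d : S → S → ℝ} (hd : ∀ x y, 0 ≤ d x y)
    {ξ η : Multiset S} (h : ξ.card ≠ η.card) :
    ((η.card : ℝ) + 1)⁻¹ ≤ dbar1 d ξ η := by
  have hne : ¬(ξ = 0 ∧ η = 0) := by
    rintro ⟨rfl, rfl⟩
    exact h rfl
  have hc := matchCost_nonneg hd ξ η
  rw [dbar1, if_neg hne]
  rcases h.lt_or_gt with hlt | hlt
  · rw [max_eq_right hlt.le, min_eq_left hlt.le]
    have h1 : (ξ.card : ℝ) + 1 ≤ η.card := by exact_mod_cast hlt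
    have h2 : (0 : ℝ) ≤ ξ.card := Nat.cast_nonneg _
    rw [inv_eq_one_div, div_le_div_iff₀ (by linarith) (by linarith)]
    nlinarith
  · rw [max_eq_left hlt.le, min_eq_right hlt.le]
    have h1 : (η.card : ℝ) + 1 ≤ ξ.card := by exact_mod_cast hlt
    have h2 : (0 : ℝ) ≤ η.card := Nat.cast_nonneg _
    rw [inv_eq_one_div, div_le_div_iff₀ (by linarith) (by linarith)]
    nlinarith

open Filter

/-- `d̄₁` metrizes the same topology on the space of finite point measures as `d₁`:
a sequence converges in `d̄₁` if and only if it converges in `d₁`. -/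
theorem dbar1_tendsto_iff_d1_tendsto {S : Type*} [MetricSpace S] [CompactSpace S]
    (hd : ∀ x y : S, dist x y ≤ 1) (ξ : ℕ → Multiset S) (ζ : Multiset S) :
    Tendsto (fun k => dbar1 dist (ξ k) ζ) atTop (nhds 0) ↔
      Tendsto (fun k => d1 dist (ξ k) ζ) atTop (nhds 0) := by
  constructor
  · intro h
    refine h.congr' ?_
    have hpos : (0 : ℝ) < ((ζ.card : ℝ) + 1)⁻¹ := by positivity
    filter_upwards [h.eventually_lt_const hpos] with k hk
    refine dbar1_eq_d1_of_card_eq _ ?_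
    by_contra hne
    exact hk.not_ge (inv_card_add_one_le_dbar1 (fun _ _ => dist_nonneg) hne)
  · intro h
    refine h.congr' ?_
    filter_upwards [h.eventually_lt_const one_pos] with k hk
    refine (dbar1_eq_d1_of_card_eq _ ?_).symm
    by_contra hne
    simp [d1, hne] at hk
end

section
/- Let K : 𝒴^l → [0,1] be symmetric and satisfy: (i) |K(u₁,…,u_l) − K(v₁,…,v_l)| ≤ (1/l) Σ_{i=1}^l d₀(u_i,v_i) for all u_i, v_i ∈ 𝒴; (ii) for every N ∈ ℕ there exist ū₁,…,ū_N ∈ 𝒴 such that for any k ∈ {1,…,l} and any 1 ≤ i₁ < … < i_k ≤ N, K(ū_{i₁},…,ū_{i_k}, u_{k+1},…,u_l) ≥ K(u₁,…,u_l) for all u₁,…,u_l ∈ 𝒳; (iii) for every k ∈ {1,…,l}, K(u₁,u₁,…,u₁,u_{k+1},…,u_l) ≤ K(u₁,…,u_l) for all u₁,…,u_l ∈ 𝒳. Define f(ξ) := (1/C(m,l)) Σ_{1 ≤ i₁ < … < i_l ≤ m} K(x_{i₁},…,x_{i_l}) for ξ = Σ_{i=1}^m δ_{x_i} with m ≥ l.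 Then for any fixed x₀ ∈ 𝒳, the extension F : 𝔑 → [0,1] given by F(ξ) := f(ξ + (l − |ξ|)⁺ δ_{x₀}) satisfies |F(ξ) − F(η)| ≤ d̄₁(ξ,η) for all ξ, η ∈ 𝔑, i.e. F ∈ F̄₂. -/
open scoped BigOperators

/-- The `U`-statistic of order `l` with kernel `K`, applied to the points of a list `xs`
with `|xs| ≥ l`: the average of `K` over all `l`-point subsets of `xs`. -/
noncomputable def listUStat {Y : Type*} (l : ℕ) (K : (Fin l → Y) → ℝ) (xs : List Y) : ℝ :=
  (∑ s ∈ (Finset.powersetCard l (Finset.univ : Finset (Fin xs.length))).attach,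
      K fun i => xs.get (Finset.orderEmbOfFin s.1 (Finset.mem_powersetCard.mp s.2).2 i))
    / (Nat.choose xs.length l : ℝ)

/-- The average of `K (x ∘ π ∘ e)` over all permutations `π` of the index type of `x`. -/
noncomputable def permAvg {Y ι : Type*} [Fintype ι] [DecidableEq ι] {l : ℕ}
    (K : (Fin l → Y) → ℝ) (x : ι → Y) (e : Fin l → ι) : ℝ :=
  (∑ π : Equiv.Perm ι, K fun i => x (π (e i))) / ((Fintype.card ι).factorial : ℝ)

section PermAvg

variable {Y ι κ : Type*} [Fintype ι] [DecidableEq ι] [Fintype κ] [DecidableEq κ] {l : ℕ}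

theorem factorial_mul_permAvg (K : (Fin l → Y) → ℝ) (x : ι → Y) (e : Fin l → ι) :
    ((Fintype.card ι).factorial : ℝ) * permAvg K x e =
      ∑ π : Equiv.Perm ι, K fun i => x (π (e i)) := by
  unfold permAvg
  have : ((Fintype.card ι).factorial : ℝ) ≠ 0 := by positivity
  field_simp

theorem exists_perm_extending {e e' : Fin l → ι} (he : Function.Injective e)
    (he' : Function.Injective e') : ∃ τ : Equiv.Perm ι, ∀ i, τ (e i) = e' i := by
  let f : {a // a ∈ Set.range e} ≃ {a // a ∈ Set.range e'} :=
    (Equiv.ofInjective e he).symm.trans (Equiv.ofInjective e' he')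
  classical
  refine ⟨f.extendSubtype, fun i => ?_⟩
  rw [Equiv.extendSubtype_apply_of_mem f (e i) ⟨i, rfl⟩]
  simp only [f, Equiv.trans_apply]
  rw [Equiv.ofInjective_symm_apply he i]
  rfl

theorem permAvg_eq_of_injective (K : (Fin l → Y) → ℝ) (x : ι → Y) {e e' : Fin l → ι}
    (he : Function.Injective e) (he' : Function.Injective e') :
    permAvg K x e = permAvg K x e' := by
  obtain ⟨τ, hτ⟩ := exists_perm_extending he he'
  unfold permAvg
  congr 1
  rw [← Equiv.sum_comp (Equiv.mulRight τ)]
  simp [hτ]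

theorem permAvg_comp_equiv (K : (Fin l → Y) → ℝ) (ε : ι ≃ κ) (x : κ → Y) (e : Fin l → ι) :
    permAvg K (fun i => x (ε i)) e = permAvg K x (fun i => ε (e i)) := by
  unfold permAvg
  rw [Fintype.card_congr ε, ← Equiv.sum_comp ε.permCongr]
  simp [Equiv.permCongr_apply]

theorem sum_perm_apply (g : ι → ℝ) (j : ι) :
    (Fintype.card ι : ℝ) * ∑ π : Equiv.Perm ι, g (π j) =
      ((Fintype.card ι).factorial : ℝ) * ∑ k, g k := by
  have h : ∀ k, ∑ π : Equiv.Perm ι, g (π k) = ∑ π : Equiv.Perm ι, g (π j) := fun k => by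
    rw [← Equiv.sum_comp (Equiv.mulRight (Equiv.swap j k))]
    simp
  calc _ = ∑ k, ∑ π : Equiv.Perm ι, g (π k) := by simp [h]
    _ = ∑ π : Equiv.Perm ι, ∑ k, g (π k) := Finset.sum_comm
    _ = ∑ π : Equiv.Perm ι, ∑ k, g k := by
      exact Finset.sum_congr rfl fun π _ => Equiv.sum_comp π g
    _ = _ := by simp [Fintype.card_perm]

theorem permAvg_mem_Icc {K : (Fin l → Y) → ℝ} (hK01 : ∀ u, K u ∈ Set.Icc (0 : ℝ) 1)
    (x : ι → Y) (e : Fin l → ι) : permAvg K x e ∈ Set.Icc (0 : ℝ) 1 := by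
  unfold permAvg
  refine ⟨div_nonneg (Finset.sum_nonneg fun _ _ => (hK01 _).1) (by positivity), ?_⟩
  refine div_le_one_of_le₀ ?_ (by positivity)
  calc _ ≤ ∑ π : Equiv.Perm ι, (1 : ℝ) := Finset.sum_le_sum fun _ _ => (hK01 _).2
    _ = _ := by simp [Fintype.card_perm]

theorem abs_permAvg_sub_le [PseudoMetricSpace Y] [Nonempty ι] (hl : 0 < l)
    {K : (Fin l → Y) → ℝ}
    (hKlip : ∀ u v : Fin l → Y, |K u - K v| ≤ (1 / (l : ℝ)) * ∑ i, dist (u i) (v i))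
    (x y : ι → Y) (e : Fin l → ι) :
    |permAvg K x e - permAvg K y e| ≤ (∑ j, dist (x j) (y j)) / (Fintype.card ι : ℝ) := by
  have hc : (0 : ℝ) < Fintype.card ι := by exact_mod_cast Fintype.card_pos
  have hf : (0 : ℝ) < ((Fintype.card ι).factorial : ℝ) := by positivity
  have hl' : (0 : ℝ) < l := by exact_mod_cast hl
  unfold permAvg
  rw [← sub_div, abs_div, abs_of_pos hf, ← Finset.sum_sub_distrib, div_le_div_iff₀ hf hc]
  calc |∑ π : Equiv.Perm ι, (K (fun i => x (π (e i))) - K fun i => y (π (e i)))|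
        * (Fintype.card ι : ℝ)
      ≤ (∑ π : Equiv.Perm ι, (1 / (l : ℝ)) * ∑ i, dist (x (π (e i))) (y (π (e i))))
        * (Fintype.card ι : ℝ) := by
        gcongr
        exact (Finset.abs_sum_le_sum_abs _ _).trans (Finset.sum_le_sum fun π _ => hKlip _ _)
    _ = (1 / (l : ℝ)) * ∑ i, (Fintype.card ι : ℝ) *
          ∑ π : Equiv.Perm ι, dist (x (π (e i))) (y (π (e i))) := by
        rw [← Finset.mul_sum, Finset.sum_comm, ← Finset.mul_sum]
        ring
    _ = (1 / (l : ℝ)) * ∑ i : Fin l, ((Fintype.card ι).factorial : ℝ) *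
          ∑ j, dist (x j) (y j) := by
        congr 1
        exact Finset.sum_congr rfl fun i _ => sum_perm_apply (fun j => dist (x j) (y j)) (e i)
    _ = _ := by
        simp only [Finset.sum_const, Finset.card_univ, Fintype.card_fin, nsmul_eq_mul]
        field_simp

/-- Averaging additionally over the permutations of the first summand. -/
theorem sum_perm_sum_eq (K : (Fin l → Y) → ℝ) (x : ι ⊕ κ → Y) (e : Fin l → ι ⊕ κ)
    (π : Equiv.Perm ι) :
    ∑ σ : Equiv.Perm (ι ⊕ κ), K (fun i => x (Equiv.sumCongr π 1 (σ (e i)))) =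
      ∑ σ : Equiv.Perm (ι ⊕ κ), K fun i => x (σ (e i)) := by
  rw [← Equiv.sum_comp (Equiv.mulLeft (Equiv.sumCongr π 1 : Equiv.Perm (ι ⊕ κ)))
    (fun σ : Equiv.Perm (ι ⊕ κ) => K fun i => x (σ (e i)))]
  rfl

theorem exists_injective_completion {κ : Type*} (hc : l ≤ Fintype.card ι) {e : Fin l → ι ⊕ κ}
    (he : Function.Injective e) :
    ∃ e₀ : Fin l → ι, Function.Injective e₀ ∧ ∀ i a, e i = Sum.inl a → e₀ i = a := by
  classical
  let s : Finset (Fin l) := Finset.univ.filter fun i => (e i).isLeft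
  have hs : ∀ i ∈ s, ∃ a, e i = Sum.inl a := fun i hi => by
    simpa [s, Sum.isLeft_iff] using hi
  have : Nonempty (Fin l ↪ ι) := Function.Embedding.nonempty_of_card_le (by simpa using hc)
  obtain ⟨e₁⟩ := this
  let g : Fin l → ι := fun i => Sum.elim id (fun _ => e₁ i) (e i)
  have hg : Set.InjOn g s := by
    intro i hi j hj hij
    obtain ⟨a, ha⟩ := hs i hi
    obtain ⟨b, hb⟩ := hs j hj
    simp only [g, ha, hb, Sum.elim_inl, id] at hij
    exact he (by rw [ha, hb, hij])
  obtain ⟨t, hst, ht⟩ := Finset.exists_superset_card_eq (s := s.image g) (n := l)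
    (by simpa using Finset.card_image_le.trans (Finset.card_le_univ s)) hc
  obtain ⟨ε, hε⟩ := Finset.exists_equiv_extend_of_card_eq (t := t)
    (by simpa using ht.symm) hst hg
  refine ⟨fun i => ε i, Subtype.val_injective.comp ε.injective, fun i a ha => ?_⟩
  exact (hε i (by simp [s, ha])).trans (by simp [g, ha])

theorem exists_threshold (p : Fin l → Prop) (hp : ∀ i j, i ≤ j → p j → p i) :
    ∃ k ≤ l, ∀ i, p i ↔ (i : ℕ) < k := by
  classical
  have hex : ∃ k : ℕ, ∀ i : Fin l, k ≤ (i : ℕ) → ¬ p i := ⟨l, fun i hi => absurd i.2 (by omega)⟩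
  refine ⟨Nat.find hex, Nat.find_min' hex fun i hi => absurd i.2 (by omega), fun i => ?_⟩
  constructor
  · intro h
    by_contra hlt
    exact Nat.find_spec hex i (by omega) h
  · intro h
    have := Nat.find_min hex h
    push Not at this
    obtain ⟨j, hj, hpj⟩ := this
    exact hp i j hj hpj

theorem kernel_le_of_domination {ι : Type*} {C : Set Y} {N : ℕ} {K : (Fin l → Y) → ℝ}
    (hKsym : ∀ (σ : Equiv.Perm (Fin l)) (u : Fin l → Y), K (u ∘ σ) = K u) {ub : Fin N → Y}
    (hub : ∀ k : ℕ, 1 ≤ k → k ≤ l →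
      ∀ g : Fin k → Fin N, StrictMono g → ∀ u : Fin l → C,
        K (fun i => if h : (i : ℕ) < k then ub (g ⟨i, h⟩) else (u i : Y)) ≥
          K fun i => (u i : Y))
    (x : ι → C) {e : Fin l → ι ⊕ Fin N} (he : Function.Injective e) {e₀ : Fin l → ι}
    (h₀ : ∀ i a, e i = Sum.inl a → e₀ i = a) :
    K (fun i => (x (e₀ i) : Y)) ≤ K fun i => Sum.elim (fun a => (x a : Y)) ub (e i) := by
  let key : Fin l → ℕ := fun i => Sum.elim (fun _ => N) (fun b : Fin N => (b : ℕ)) (e i)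
  let σ := Tuple.sort key
  have hmono : Monotone (key ∘ σ) := Tuple.monotone_sort key
  obtain ⟨k, hkl, hk⟩ := exists_threshold (fun i => key (σ i) < N)
    fun i j hij hj => (hmono hij).trans_lt hj
  have hright : ∀ i : Fin l, (i : ℕ) < k → ∃ b, e (σ i) = Sum.inr b := fun i hi => by
    have := (hk i).2 hi
    rcases h : e (σ i) with a | b
    · simp [key, h] at this
    · exact ⟨b, rfl⟩
  have hleft : ∀ i : Fin l, ¬ (i : ℕ) < k → e (σ i) = Sum.inl (e₀ (σ i)) := fun i hi => by
    rcases h : e (σ i) with a | b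
    · rw [h₀ _ _ h]
    · exact absurd ((hk i).1 (by simp [key, h])) hi
  rw [← hKsym σ, ← hKsym σ fun i => Sum.elim (fun a => (x a : Y)) ub (e i)]
  rcases Nat.eq_zero_or_pos k with rfl | hpos
  · apply le_of_eq
    congr 1
    funext i
    simp [hleft i (by omega)]
  choose b hb using hright
  let g : Fin k → Fin N := fun i => b ⟨i, i.2.trans_le hkl⟩ i.2
  have hgkey : ∀ i : Fin k, (g i : ℕ) = key (σ ⟨i, i.2.trans_le hkl⟩) := fun i => by
    simp [key, g, hb ⟨i, i.2.trans_le hkl⟩ i.2]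
  have hg : StrictMono g := by
    apply Monotone.strictMono_of_injective
    · intro i j hij
      rw [Fin.le_def, hgkey, hgkey]
      exact hmono (Fin.mk_le_mk.2 hij)
    · intro i j hij
      have h1 := hb ⟨i, i.2.trans_le hkl⟩ i.2
      have h2 := hb ⟨j, j.2.trans_le hkl⟩ j.2
      have := σ.injective (he (h1.trans ((congrArg Sum.inr hij).trans h2.symm)))
      simpa [Fin.ext_iff] using this
  have := hub k hpos hkl g hg fun i => x (e₀ (σ i))
  refine this.trans (le_of_eq ?_)
  congr 1
  funext i
  simp only [Function.comp]
  split_ifs with h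
  · simp [hb i h, g]
  · simp [hleft i h]

/-- Adding dominating points does not decrease the permutation average. -/
theorem permAvg_le_of_domination {C : Set Y} {N : ℕ} {K : (Fin l → Y) → ℝ}
    (hKsym : ∀ (σ : Equiv.Perm (Fin l)) (u : Fin l → Y), K (u ∘ σ) = K u) {ub : Fin N → Y}
    (hub : ∀ k : ℕ, 1 ≤ k → k ≤ l →
      ∀ g : Fin k → Fin N, StrictMono g → ∀ u : Fin l → C,
        K (fun i => if h : (i : ℕ) < k then ub (g ⟨i, h⟩) else (u i : Y)) ≥
          K fun i => (u i : Y))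
    (hc : l ≤ Fintype.card ι) (x : ι → C) {e : Fin l → ι} (he : Function.Injective e)
    {e' : Fin l → ι ⊕ Fin N} (he' : Function.Injective e') :
    permAvg K (fun a => (x a : Y)) e ≤ permAvg K (Sum.elim (fun a => (x a : Y)) ub) e' := by
  have hf : (0 : ℝ) < ((Fintype.card ι).factorial : ℝ) := by positivity
  have hf' : (0 : ℝ) < ((Fintype.card (ι ⊕ Fin N)).factorial : ℝ) := by positivity
  refine le_of_mul_le_mul_left (le_of_mul_le_mul_left ?_ hf) hf'
  rw [factorial_mul_permAvg, mul_left_comm]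
  calc _ = ∑ σ : Equiv.Perm (ι ⊕ Fin N),
          ((Fintype.card ι).factorial : ℝ) * permAvg K (fun a => (x a : Y)) e := by
        simp [Fintype.card_perm]
    _ ≤ ∑ σ : Equiv.Perm (ι ⊕ Fin N), ∑ π : Equiv.Perm ι,
          K (fun i => Sum.elim (fun a => (x a : Y)) ub (Equiv.sumCongr π 1 (σ (e' i)))) := by
        refine Finset.sum_le_sum fun σ _ => ?_
        obtain ⟨e₀, he₀, h₀⟩ := exists_injective_completion hc (σ.injective.comp he')
        rw [permAvg_eq_of_injective K _ he he₀, factorial_mul_permAvg]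
        refine Finset.sum_le_sum fun π _ => ?_
        refine kernel_le_of_domination hKsym hub x
          (e := fun i => Equiv.sumCongr π 1 (σ (e' i))) (e₀ := fun i => π (e₀ i))
          ((Equiv.injective _).comp (σ.injective.comp he')) fun i a hi => ?_
        rcases h : σ (e' i) with c | c
        · rw [h₀ i c h]
          simpa [h] using hi
        · simp [h] at hi
    _ = ∑ π : Equiv.Perm ι, ∑ σ : Equiv.Perm (ι ⊕ Fin N),
          K (fun i => Sum.elim (fun a => (x a : Y)) ub (σ (e' i))) := by
        rw [Finset.sum_comm]
        exact Finset.sum_congr rfl fun π _ => sum_perm_sum_eq K _ e' π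
    _ = _ := by simp [Fintype.card_perm]

theorem kernel_le_of_coincidence {C : Set Y} (hl : 0 < l) {K : (Fin l → Y) → ℝ}
    (hKsym : ∀ (σ : Equiv.Perm (Fin l)) (u : Fin l → Y), K (u ∘ σ) = K u)
    (hKdiag : ∀ k : ℕ, 1 ≤ k → k ≤ l → ∀ u : Fin l → C,
      K (fun i => if (i : ℕ) < k then (u ⟨0, hl⟩ : Y) else (u i : Y)) ≤
        K fun i => (u i : Y))
    {p q : Fin l} (hpq : p ≠ q) (u : Fin l → C) :
    K (fun i => ((Function.update u p (u q)) i : Y)) ≤ K fun i => (u i : Y) := by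
  have h2 : 2 ≤ l := by
    have := p.2
    have := q.2
    have : (p : ℕ) ≠ q := fun h => hpq (Fin.ext h)
    omega
  obtain ⟨τ, hτ⟩ := exists_perm_extending (e := ![(⟨0, hl⟩ : Fin l), ⟨1, h2⟩]) (e' := ![q, p])
    (by intro i j; fin_cases i <;> fin_cases j <;> simp)
    (by intro i j; fin_cases i <;> fin_cases j <;> simp [hpq, hpq.symm])
  have h0 : τ ⟨0, hl⟩ = q := hτ 0
  have h1 : τ ⟨1, h2⟩ = p := hτ 1
  have := hKdiag 2 (by norm_num) h2 (u ∘ τ)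
  rw [← hKsym τ, ← hKsym τ fun i => (u i : Y)]
  refine le_trans (le_of_eq ?_) this
  congr 1
  funext i
  simp only [Function.comp]
  by_cases hi0 : i = ⟨0, hl⟩
  · subst hi0
    simp [h0, Function.update_of_ne hpq.symm]
  by_cases hi1 : i = ⟨1, h2⟩
  · subst hi1
    simp [h0, h1]
  · have : ¬ (i : ℕ) < 2 := by
      rw [Fin.ext_iff] at hi0 hi1
      simp only at hi0 hi1
      omega
    have hne : τ i ≠ p := fun h => hi1 (τ.injective (h.trans h1.symm))
    simp [this, Function.update_of_ne hne]

/-- Repeating indices does not increase the permutation average. -/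
theorem permAvg_le_of_coincidence {C : Set Y} (hl : 0 < l) {K : (Fin l → Y) → ℝ}
    (hKsym : ∀ (σ : Equiv.Perm (Fin l)) (u : Fin l → Y), K (u ∘ σ) = K u)
    (hKdiag : ∀ k : ℕ, 1 ≤ k → k ≤ l → ∀ u : Fin l → C,
      K (fun i => if (i : ℕ) < k then (u ⟨0, hl⟩ : Y) else (u i : Y)) ≤
        K fun i => (u i : Y))
    (hc : l ≤ Fintype.card ι) (x : ι → C) {e : Fin l → ι} (he : Function.Injective e)
    (φ : Fin l → ι) :
    permAvg K (fun a => (x a : Y)) φ ≤ permAvg K (fun a => (x a : Y)) e := by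
  induction hd : l - (Finset.univ.image φ).card using Nat.strong_induction_on
    generalizing φ with
  | _ d ih =>
    by_cases hφ : Function.Injective φ
    · exact (permAvg_eq_of_injective K _ hφ he).le
    simp only [Function.Injective, not_forall] at hφ
    obtain ⟨p, q, hφpq, hpq⟩ := hφ
    have hlt : (Finset.univ.image φ).card < l := by
      refine lt_of_le_of_ne (by simpa using Finset.card_image_le (s := Finset.univ) (f := φ))
        fun h => hpq ?_
      exact Finset.card_image_iff.1 (h.trans (by simp)) (by simp) (by simp) hφpq
    obtain ⟨v, hv⟩ : ∃ v, v ∉ Finset.univ.image φ := by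
      by_contra! h
      have := Finset.card_le_card (s := Finset.univ) (t := Finset.univ.image φ) fun a _ => h a
      rw [Finset.card_univ] at this
      omega
    let ψ := Function.update φ p v
    have hψ : φ = Function.update ψ p (ψ q) := by
      funext i
      by_cases hi : i = p
      · subst hi
        simp [ψ, Function.update_of_ne (Ne.symm hpq), hφpq]
      · simp [ψ, hi]
    have himg : insert v (Finset.univ.image φ) ⊆ Finset.univ.image ψ := by
      intro a ha
      rw [Finset.mem_insert] at ha
      rcases ha with rfl | ha
      · exact Finset.mem_image.2 ⟨p, by simp, by simp [ψ]⟩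
      · obtain ⟨i, -, rfl⟩ := Finset.mem_image.1 ha
        by_cases hi : i = p
        · exact Finset.mem_image.2 ⟨q, by simp, by
            simp [ψ, Function.update_of_ne (Ne.symm hpq), hi, hφpq]⟩
        · exact Finset.mem_image.2 ⟨i, by simp, by simp [ψ, hi]⟩
    have hcard := Finset.card_le_card himg
    rw [Finset.card_insert_of_notMem hv] at hcard
    refine le_trans ?_ (ih _ (by omega) ψ rfl)
    unfold permAvg
    gcongr with π
    have := kernel_le_of_coincidence hl hKsym hKdiag hpq fun i => x (π (ψ i))
    refine le_trans (le_of_eq ?_) this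
    congr 1
    funext i
    rw [hψ]
    by_cases hi : i = p
    · subst hi
      simp
    · simp [hi]

/-- Suitable repetitions of the given points do not increase the permutation average. -/
theorem exists_permAvg_le {C : Set Y} (hl : 0 < l) {K : (Fin l → Y) → ℝ}
    (hKsym : ∀ (σ : Equiv.Perm (Fin l)) (u : Fin l → Y), K (u ∘ σ) = K u)
    (hKdiag : ∀ k : ℕ, 1 ≤ k → k ≤ l → ∀ u : Fin l → C,
      K (fun i => if (i : ℕ) < k then (u ⟨0, hl⟩ : Y) else (u i : Y)) ≤
        K fun i => (u i : Y))
    (hc : l ≤ Fintype.card ι) (x : ι → C) {e : Fin l → ι} (he : Function.Injective e)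
    (e' : Fin l → ι ⊕ κ) :
    ∃ w : κ → Y, permAvg K (Sum.elim (fun a => (x a : Y)) w) e' ≤
      permAvg K (fun a => (x a : Y)) e := by
  have hf : (0 : ℝ) < ((Fintype.card ι).factorial : ℝ) := by positivity
  have hf' : (0 : ℝ) < ((Fintype.card (ι ⊕ κ)).factorial : ℝ) := by positivity
  have : Nonempty ι := ⟨e ⟨0, hl⟩⟩
  set X : ι → Y := fun a => (x a : Y)
  suffices h : ∃ r ∈ (Finset.univ : Finset (κ → ι)),
      permAvg K (Sum.elim X fun b => X (r b)) e' ≤ permAvg K X e by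
    obtain ⟨r, -, hr⟩ := h
    exact ⟨_, hr⟩
  refine Finset.exists_le_of_sum_le Finset.univ_nonempty ?_
  refine le_of_mul_le_mul_left (le_of_mul_le_mul_left ?_ hf) hf'
  have hreindex : ∀ (π : Equiv.Perm ι) (σ : Equiv.Perm (ι ⊕ κ)),
      ∑ r : κ → ι, K (fun i =>
        Sum.elim X (fun b => X (r b)) (Equiv.sumCongr π 1 (σ (e' i)))) =
      ∑ r : κ → ι, K (fun i => X (π (Sum.elim id r (σ (e' i))))) := fun π σ => by
    rw [← Equiv.sum_comp (Equiv.arrowCongr (Equiv.refl κ) π)]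
    refine Finset.sum_congr rfl fun r _ => ?_
    congr 1
    funext i
    rcases σ (e' i) with a | b <;> simp
  calc _ = ∑ π : Equiv.Perm ι, ∑ r : κ → ι, ∑ σ : Equiv.Perm (ι ⊕ κ),
          K (fun i => Sum.elim X (fun b => X (r b)) (σ (e' i))) := by
        simp only [← factorial_mul_permAvg, ← Finset.mul_sum]
        rw [Finset.sum_const, Finset.card_univ, Fintype.card_perm, nsmul_eq_mul]
        ring
    _ = ∑ π : Equiv.Perm ι, ∑ r : κ → ι, ∑ σ : Equiv.Perm (ι ⊕ κ),
          K (fun i => Sum.elim X (fun b => X (r b)) (Equiv.sumCongr π 1 (σ (e' i)))) :=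
        Finset.sum_congr rfl fun π _ => Finset.sum_congr rfl fun r _ =>
          (sum_perm_sum_eq K _ e' π).symm
    _ = ∑ π : Equiv.Perm ι, ∑ σ : Equiv.Perm (ι ⊕ κ), ∑ r : κ → ι,
          K (fun i => X (π (Sum.elim id r (σ (e' i))))) := by
        refine Finset.sum_congr rfl fun π _ => ?_
        rw [Finset.sum_comm]
        exact Finset.sum_congr rfl fun σ _ => hreindex π σ
    _ = ∑ σ : Equiv.Perm (ι ⊕ κ), ∑ r : κ → ι, ((Fintype.card ι).factorial : ℝ) *
          permAvg K X (fun i => Sum.elim id r (σ (e' i))) := by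
        rw [Finset.sum_comm]
        refine Finset.sum_congr rfl fun σ _ => ?_
        rw [Finset.sum_comm]
        simp only [factorial_mul_permAvg]
    _ ≤ ∑ σ : Equiv.Perm (ι ⊕ κ), ∑ r : κ → ι, ((Fintype.card ι).factorial : ℝ) *
          permAvg K X e := by
        gcongr
        exact permAvg_le_of_coincidence hl hKsym hKdiag hc x he _
    _ = _ := by
        rw [Finset.sum_const, Finset.card_univ, Fintype.card_perm, nsmul_eq_mul,
          ← Finset.mul_sum]
        ring

theorem abs_permAvg_sub_permAvg_sum_le {Y : Type*} [MetricSpace Y]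
    (hdY : ∀ a b : Y, dist a b ≤ 1) {C : Set Y} (hl : 0 < l) {K : (Fin l → Y) → ℝ}
    (hKsym : ∀ (σ : Equiv.Perm (Fin l)) (u : Fin l → Y), K (u ∘ σ) = K u)
    (hKlip : ∀ u v : Fin l → Y, |K u - K v| ≤ (1 / (l : ℝ)) * ∑ i, dist (u i) (v i))
    {N : ℕ} {ub : Fin N → Y}
    (hub : ∀ k : ℕ, 1 ≤ k → k ≤ l →
      ∀ g : Fin k → Fin N, StrictMono g → ∀ u : Fin l → C,
        K (fun i => if h : (i : ℕ) < k then ub (g ⟨i, h⟩) else (u i : Y)) ≥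
          K fun i => (u i : Y))
    (hKdiag : ∀ k : ℕ, 1 ≤ k → k ≤ l → ∀ u : Fin l → C,
      K (fun i => if (i : ℕ) < k then (u ⟨0, hl⟩ : Y) else (u i : Y)) ≤
        K fun i => (u i : Y))
    (hc : l ≤ Fintype.card ι) (x : ι → C) (y : ι ⊕ Fin N → Y) {e : Fin l → ι}
    (he : Function.Injective e) {e' : Fin l → ι ⊕ Fin N} (he' : Function.Injective e') :
    |permAvg K (fun a => (x a : Y)) e - permAvg K y e'| ≤
      (∑ a, dist (x a : Y) (y (Sum.inl a)) + N) / ((Fintype.card ι : ℝ) + N) := by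
  have : Nonempty ι := ⟨e ⟨0, hl⟩⟩
  have hw : ∀ w : Fin N → Y, |permAvg K (Sum.elim (fun a => (x a : Y)) w) e' - permAvg K y e'| ≤
      (∑ a, dist (x a : Y) (y (Sum.inl a)) + N) / ((Fintype.card ι : ℝ) + N) := fun w => by
    refine (abs_permAvg_sub_le hl hKlip _ y e').trans ?_
    simp only [Fintype.sum_sum_type, Sum.elim_inl, Sum.elim_inr, Fintype.card_sum,
      Fintype.card_fin, Nat.cast_add]
    gcongr
    calc _ ≤ ∑ b : Fin N, (1 : ℝ) := Finset.sum_le_sum fun _ _ => hdY _ _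
      _ = N := by simp
  obtain ⟨w, hwle⟩ := exists_permAvg_le hl hKsym hKdiag hc x he e'
  have h1 := permAvg_le_of_domination hKsym hub hc x he he'
  have h2 := abs_le.1 (hw ub)
  have h3 := abs_le.1 (hw w)
  exact abs_le.2 ⟨by linarith, by linarith⟩

end PermAvg

theorem listUStat_eq_permAvg {Y : Type*} {l : ℕ} {K : (Fin l → Y) → ℝ}
    (hKsym : ∀ (σ : Equiv.Perm (Fin l)) (u : Fin l → Y), K (u ∘ σ) = K u) (xs : List Y)
    {e : Fin l → Fin xs.length} (he : Function.Injective e) :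
    listUStat l K xs = permAvg K xs.get e := by
  let P := {s // s ∈ Finset.powersetCard l (Finset.univ : Finset (Fin xs.length))}
  let ord : P → Fin l → Fin xs.length := fun s =>
    Finset.orderEmbOfFin s.1 (Finset.mem_powersetCard.mp s.2).2
  have hln : l ≤ xs.length := by simpa using Fintype.card_le_of_injective e he
  have hmem : ∀ (s : P) a, a ∈ s.1 ↔ ∃ i, ord s i = a := fun s a => by
    have := Finset.range_orderEmbOfFin s.1 (Finset.mem_powersetCard.mp s.2).2
    rw [← Finset.mem_coe, ← this]
    rfl
  have hordinj : ∀ s, Function.Injective (ord s) := fun s =>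
    (Finset.orderEmbOfFin s.1 (Finset.mem_powersetCard.mp s.2).2).injective
  let act : Equiv.Perm (Fin xs.length) → P → P := fun π s =>
    ⟨s.1.map π.toEmbedding, by
      have := s.2
      simp only [Finset.mem_powersetCard, Finset.subset_univ, true_and] at this ⊢
      simpa using this⟩
  have hact : ∀ π, Function.Bijective (act π) := fun π => by
    refine Finite.injective_iff_bijective.1 fun s t hst => ?_
    exact Subtype.ext (Finset.map_injective _ (congrArg Subtype.val hst))
  have hKact : ∀ π s, K (fun i => xs.get (ord (act π s) i)) =
      K fun i => xs.get (π (ord s i)) := fun π s => by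
    have hex : ∀ i, ∃ j, ord (act π s) j = π (ord s i) := fun i =>
      (hmem _ _).1 (by simpa [act] using (hmem s _).2 ⟨i, rfl⟩)
    choose τ hτ using hex
    have hτinj : Function.Injective τ := fun i j hij => by
      apply hordinj s
      apply π.injective
      rw [← hτ, ← hτ, hij]
    rw [← hKsym (Equiv.ofBijective τ (Finite.injective_iff_bijective.1 hτinj))]
    congr 1
    funext i
    simp [hτ]
  have hchoose : (0 : ℝ) < xs.length.choose l := by exact_mod_cast Nat.choose_pos hln
  have hcardP : Fintype.card P = xs.length.choose l := by simp [P]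
  have hfac : (0 : ℝ) < ((Fintype.card (Fin xs.length)).factorial : ℝ) := by positivity
  have hsum : listUStat l K xs = (∑ s : P, K fun i => xs.get (ord s i)) / xs.length.choose l := rfl
  rw [hsum, div_eq_iff hchoose.ne']
  refine mul_left_cancel₀ hfac.ne' ?_
  calc _ = ∑ π : Equiv.Perm (Fin xs.length), ∑ s : P, K fun i => xs.get (ord s i) := by
        simp [Fintype.card_perm]
    _ = ∑ π : Equiv.Perm (Fin xs.length), ∑ s : P, K fun i => xs.get (π (ord s i)) := by
        refine Finset.sum_congr rfl fun π _ => ?_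
        rw [← (hact π).sum_comp fun s => K fun i => xs.get (ord s i)]
        simp only [hKact]
    _ = ∑ s : P, ((Fintype.card (Fin xs.length)).factorial : ℝ) * permAvg K xs.get e := by
        rw [Finset.sum_comm]
        refine Finset.sum_congr rfl fun s _ => ?_
        rw [permAvg_eq_of_injective K _ he (hordinj s), factorial_mul_permAvg]
    _ = _ := by
        rw [Finset.sum_const, Finset.card_univ, hcardP, nsmul_eq_mul]
        ring

theorem listUStat_mem_Icc {Y : Type*} {l : ℕ} {K : (Fin l → Y) → ℝ}
    (hK01 : ∀ u : Fin l → Y, K u ∈ Set.Icc (0 : ℝ) 1)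
    (hKsym : ∀ (σ : Equiv.Perm (Fin l)) (u : Fin l → Y), K (u ∘ σ) = K u) {xs : List Y}
    (hxs : l ≤ xs.length) : listUStat l K xs ∈ Set.Icc (0 : ℝ) 1 := by
  rw [listUStat_eq_permAvg hKsym xs (Fin.castLE_injective hxs)]
  exact permAvg_mem_Icc hK01 _ _

theorem sum_zipWith_eq_sum_fin {S : Type*} (d : S → S → ℝ) (xs ys : List S)
    (h : xs.length ≤ ys.length) :
    (List.zipWith d xs ys).sum = ∑ i, d (xs.get i) (ys.get (Fin.castLE h i)) := by
  induction xs generalizing ys with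
  | nil => simp
  | cons x xs ih =>
    cases ys with
    | nil => simp at h
    | cons y ys =>
      have h' : xs.length ≤ ys.length := by simpa using h
      simp only [List.zipWith_cons_cons, List.sum_cons, ih ys h']
      exact (Fin.sum_univ_succ (n := xs.length) fun i =>
        d ((x :: xs).get i) ((y :: ys).get (Fin.castLE h i))).symm

theorem sum_zipWith_append_le {S : Type*} {d : S → S → ℝ} (hd : ∀ a b, d a b ≤ 1)
    (xs as ys : List S) :
    (List.zipWith d (xs ++ as) ys).sum ≤ (List.zipWith d xs ys).sum + as.length := by
  induction xs generalizing ys with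
  | nil =>
    induction as generalizing ys with
    | nil => simp
    | cons a as ih =>
      cases ys with
      | nil => simp; positivity
      | cons y ys =>
        have := ih ys
        have := hd a y
        simp only [List.nil_append, List.zipWith_cons_cons, List.sum_cons, List.zipWith_nil_left,
          List.sum_nil, List.length_cons, Nat.cast_add, Nat.cast_one] at *
        linarith
  | cons x xs ih =>
    cases ys with
    | nil => simp
    | cons y ys =>
      have := ih ys
      simp only [List.cons_append, List.zipWith_cons_cons, List.sum_cons]
      linarith

theorem abs_listUStat_sub_le {Y : Type*} [MetricSpace Y] (hdY : ∀ a b : Y, dist a b ≤ 1)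
    {C : Set Y} {l : ℕ} (hl : 0 < l) {K : (Fin l → Y) → ℝ}
    (hKsym : ∀ (σ : Equiv.Perm (Fin l)) (u : Fin l → Y), K (u ∘ σ) = K u)
    (hKlip : ∀ u v : Fin l → Y, |K u - K v| ≤ (1 / (l : ℝ)) * ∑ i, dist (u i) (v i))
    (hKdom : ∀ N : ℕ, ∃ ub : Fin N → Y, ∀ k : ℕ, 1 ≤ k → k ≤ l →
      ∀ g : Fin k → Fin N, StrictMono g → ∀ u : Fin l → C,
        K (fun i => if h : (i : ℕ) < k then ub (g ⟨i, h⟩) else (u i : Y)) ≥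
          K fun i => (u i : Y))
    (hKdiag : ∀ k : ℕ, 1 ≤ k → k ≤ l → ∀ u : Fin l → C,
      K (fun i => if (i : ℕ) < k then (u ⟨0, hl⟩ : Y) else (u i : Y)) ≤
        K fun i => (u i : Y))
    (xs ys : List C) (hxs : l ≤ xs.length) (hxy : xs.length ≤ ys.length) :
    |listUStat l K (xs.map Subtype.val) - listUStat l K (ys.map Subtype.val)| ≤
      ((List.zipWith dist xs ys).sum + ((ys.length : ℝ) - xs.length)) / ys.length := by
  obtain ⟨p, hp⟩ := Nat.exists_eq_add_of_le hxy
  obtain ⟨ub, hub⟩ := hKdom p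
  have hx : xs.length = (xs.map Subtype.val).length := by simp
  have hy : xs.length + p = (ys.map Subtype.val).length := by simp [hp]
  let εx : Fin xs.length ≃ Fin (xs.map Subtype.val).length := finCongr hx
  let εy : Fin xs.length ⊕ Fin p ≃ Fin (ys.map Subtype.val).length :=
    finSumFinEquiv.trans (finCongr hy)
  let e : Fin l → Fin xs.length := Fin.castLE hxs
  let e' : Fin l → Fin xs.length ⊕ Fin p := fun i => Sum.inl (e i)
  have he : Function.Injective e := Fin.castLE_injective hxs
  have he' : Function.Injective e' := Sum.inl_injective.comp he
  have key := abs_permAvg_sub_permAvg_sum_le hdY hl hKsym hKlip hub hKdiag (by simpa using hxs)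
    xs.get (fun s => (ys.map Subtype.val).get (εy s)) he he'
  rw [permAvg_comp_equiv K εy, ← listUStat_eq_permAvg hKsym _ (e := fun i => εy (e' i)) (εy.injective.comp he')] at key
  have hxget : (fun a => (xs.get a : Y)) = fun a => (xs.map Subtype.val).get (εx a) := by
    funext a
    simp [εx]
  rw [hxget, permAvg_comp_equiv K εx,
    ← listUStat_eq_permAvg hKsym _ (e := fun i => εx (e i)) (εx.injective.comp he)] at key
  refine key.trans (le_of_eq ?_)
  have hp' : (ys.length : ℝ) = xs.length + p := by exact_mod_cast hp
  rw [sum_zipWith_eq_sum_fin _ _ _ hxy, hp']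
  simp [εy, Subtype.dist_eq]

/-- `U`-statistics with symmetric kernels `K : 𝒴^l → [0,1]` satisfying the Lipschitz
condition (i), the domination condition (ii) and the diagonal condition (iii), when
extended to all of `𝔑` by `F(ξ) := f(ξ + (l - |ξ|)⁺ δ_{x₀})`, are `d̄₁`-Lipschitz
with constant 1 and `[0,1]`-valued, i.e. belong to `F̄₂`. -/
theorem ustat_mem_Fbar2 {Y : Type*} [MetricSpace Y] (hdY : ∀ a b : Y, dist a b ≤ 1)
    (C : Set Y) (hC : IsCompact C) (l : ℕ) (hl : 0 < l)
    (K : (Fin l → Y) → ℝ)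
    (hK01 : ∀ u : Fin l → Y, K u ∈ Set.Icc (0 : ℝ) 1)
    (hKsym : ∀ (σ : Equiv.Perm (Fin l)) (u : Fin l → Y), K (u ∘ σ) = K u)
    (hKlip : ∀ u v : Fin l → Y, |K u - K v| ≤ (1 / (l : ℝ)) * ∑ i, dist (u i) (v i))
    (hKdom : ∀ N : ℕ, ∃ ub : Fin N → Y, ∀ k : ℕ, 1 ≤ k → k ≤ l →
      ∀ g : Fin k → Fin N, StrictMono g → ∀ u : Fin l → C,
        K (fun i => if h : (i : ℕ) < k then ub (g ⟨i, h⟩) else (u i : Y)) ≥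
          K fun i => (u i : Y))
    (hKdiag : ∀ k : ℕ, 1 ≤ k → k ≤ l → ∀ u : Fin l → C,
      K (fun i => if (i : ℕ) < k then (u ⟨0, hl⟩ : Y) else (u i : Y)) ≤
        K fun i => (u i : Y))
    (x₀ : C) (F : Multiset C → ℝ)
    (hF : ∀ xs : List C, l ≤ xs.length →
      F (xs : Multiset C) = listUStat l K (xs.map fun c => (c : Y)))
    (hFext : ∀ ξ : Multiset C, F ξ = F (ξ + Multiset.replicate (l - ξ.card) x₀)) :
    (∀ ξ : Multiset C, F ξ ∈ Set.Icc (0 : ℝ) 1) ∧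
    ∀ ξ η : Multiset C, |F ξ - F η| ≤ dbar1 dist ξ η := by
  have hCd : ∀ a b : C, dist a b ≤ 1 := fun a b => hdY a b
  have hF' : ∀ xs : List C, l ≤ xs.length →
      F (xs : Multiset C) = listUStat l K (xs.map Subtype.val) := fun xs hxs => by
    rw [hF xs hxs]
    congr 1
    simp [List.map_eq_flatMap]
  have hFpad : ∀ xs : List C,
      F (xs : Multiset C) = F ((xs ++ List.replicate (l - xs.length) x₀ : List C) : Multiset C) :=
    fun xs => by
      rw [hFext]
      simp [← Multiset.coe_add, ← Multiset.coe_replicate]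
  have hlong : ∀ xs ys : List C, l ≤ xs.length → xs.length ≤ ys.length →
      |F xs - F ys| ≤
        ((List.zipWith dist xs ys).sum + ((ys.length : ℝ) - xs.length)) / ys.length :=
    fun xs ys hxs hxy => by
      rw [hF' xs hxs, hF' ys (hxs.trans hxy)]
      exact abs_listUStat_sub_le hdY hl hKsym hKlip hKdom hKdiag xs ys hxs hxy
  have hmain : ∀ xs ys : List C, xs.length ≤ ys.length → 0 < ys.length →
      |F xs - F ys| ≤
        ((List.zipWith dist xs ys).sum + ((ys.length : ℝ) - xs.length)) / ys.length := by
    intro xs ys hxy hy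
    have hy' : (0 : ℝ) < ys.length := by exact_mod_cast hy
    rcases le_or_gt l xs.length with hxs | hxs
    · exact hlong xs ys hxs hxy
    rcases le_or_gt l ys.length with hys | hys
    · rw [hFpad xs]
      have hlen : (xs ++ List.replicate (l - xs.length) x₀).length = l := by
        simp; omega
      refine (hlong _ ys hlen.ge (hlen.le.trans hys)).trans ?_
      have := sum_zipWith_append_le hCd xs (List.replicate (l - xs.length) x₀) ys
      rw [hlen]
      rw [List.length_replicate, Nat.cast_sub hxs.le] at this
      gcongr ?_ / _
      linarith
    · rw [hFpad xs, hFpad ys]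
      set zs := xs ++ List.replicate (ys.length - xs.length) x₀ with hzs
      have hzlen : zs.length = ys.length := by
        simp [hzs]; omega
      have hsplit : xs ++ List.replicate (l - xs.length) x₀ =
          zs ++ List.replicate (l - ys.length) x₀ := by
        rw [hzs, List.append_assoc, List.replicate_append_replicate]
        congr 2
        omega
      have hlx : (zs ++ List.replicate (l - ys.length) x₀).length = l := by
        simp [hzlen]; omega
      have hly : (ys ++ List.replicate (l - ys.length) x₀).length = l := by
        simp; omega
      rw [hsplit]
      refine (hlong _ _ hlx.ge (hlx.trans hly.symm).le).trans ?_
      rw [hlx, hly, List.zipWith_append hzlen, List.sum_append, List.zipWith_replicate]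
      have h1 := sum_zipWith_append_le hCd xs (List.replicate (ys.length - xs.length) x₀) ys
      rw [List.length_replicate, Nat.cast_sub hxy, ← hzs] at h1
      have h0 : 0 ≤ (List.zipWith dist zs ys).sum := by
        rw [sum_zipWith_eq_sum_fin _ _ _ hzlen.le]
        exact Finset.sum_nonneg fun _ _ => dist_nonneg
      simp only [dist_self, List.sum_replicate, smul_zero, add_zero, sub_self]
      have h2 := h0.trans h1
      gcongr
  refine ⟨fun ξ => ?_, fun ξ η => ?_⟩
  · induction ξ using Quotient.inductionOn with
    | _ xs =>
      change F (xs : Multiset C) ∈ _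
      have hlen : l ≤ (xs ++ List.replicate (l - xs.length) x₀).length := by
        simp; omega
      rw [hFpad xs, hF' _ hlen]
      exact listUStat_mem_Icc hK01 hKsym (by simpa using hlen)
  · unfold dbar1
    split_ifs with h0
    · simp [h0.1, h0.2]
    have hpos : 0 < max ξ.card η.card := by
      by_contra hle
      have : ξ.card = 0 ∧ η.card = 0 := by omega
      exact h0 ⟨Multiset.card_eq_zero.1 this.1, Multiset.card_eq_zero.1 this.2⟩
    have hpos' : (0 : ℝ) < (max ξ.card η.card : ℕ) := by exact_mod_cast hpos
    rw [le_div_iff₀ hpos', ← sub_le_iff_le_add]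
    refine le_csInf ⟨_, ξ.toList, η.toList, by simp, by simp, rfl⟩ ?_
    rintro c ⟨xs, ys, rfl, rfl, rfl⟩
    rw [sub_le_iff_le_add, ← le_div_iff₀ hpos']
    simp only [Multiset.coe_card] at hpos ⊢
    rcases le_total xs.length ys.length with h | h
    · rw [max_eq_right h] at hpos ⊢
      rw [min_eq_left h]
      exact hmain xs ys h hpos
    · rw [max_eq_left h] at hpos ⊢
      rw [min_eq_right h, abs_sub_comm, List.zipWith_comm]
      simpa only [dist_comm] using hmain ys xs h hpos
end

section
/- Monotonicity of U-statistic averages under adding dominating points: let K : 𝒴^l → [0,1] be symmetric, let m ≥ l, let x₁,…,x_m ∈ 𝒳, and let x_{m+1},…,x_n ∈ 𝒴 (with n > m) be points such that for every k ∈ {1,…,l} and every choice of k indices m+1 ≤ i₁ < … < i_k ≤ n, K(x_{i₁},…,x_{i_k}, u_{k+1},…,u_l) ≥ K(u₁,…,u_l) for all u₁,…,u_l ∈ 𝒳. Then (1/C(n,l)) Σ_{1 ≤ i₁ < … < i_l ≤ n} K(x_{i₁},…,x_{i_l}) ≥ (1/C(m,l)) Σ_{1 ≤ i₁ < … < i_l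 ≤ m} K(x_{i₁},…,x_{i_l}). -/
open scoped BigOperators

/-- The `U`-statistic average of order `l` with kernel `K` over the points
`x 0, …, x (n-1)`: the average of `K` over all `l`-element index subsets. -/
noncomputable def ustatAvg {Y : Type*} (l : ℕ) (K : (Fin l → Y) → ℝ)
    (n : ℕ) (x : Fin n → Y) : ℝ :=
  (∑ s ∈ (Finset.powersetCard l (Finset.univ : Finset (Fin n))).attach,
      K fun i => x (Finset.orderEmbOfFin s.1 (Finset.mem_powersetCard.mp s.2).2 i))
    / (Nat.choose n l : ℝ)

/-- Splitting each element of `Q` evenly over its `r`-neighbours in `P` couples the uniform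
averages over `P` and `Q`, provided that every element of `P` receives the same mass. -/
theorem Finset.sum_div_card_le_of_uniform_mass {α β : Type*} (P : Finset α) (Q : Finset β)
    (r : α → β → Prop) [∀ a b, Decidable (r a b)] (F : α → ℝ) (G : β → ℝ) (w : ℝ)
    (hP : P.Nonempty) (hQ : Q.Nonempty)
    (hne : ∀ b ∈ Q, (P.filter (r · b)).Nonempty)
    (hw : ∀ a ∈ P, ∑ b ∈ Q with r a b, ((P.filter (r · b)).card : ℝ)⁻¹ = w)
    (hFG : ∀ a ∈ P, ∀ b ∈ Q, r a b → F a ≤ G b) :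
    (∑ a ∈ P, F a) / (P.card : ℝ) ≤ (∑ b ∈ Q, G b) / (Q.card : ℝ) := by
  have hpos : ∀ b ∈ Q, (0 : ℝ) < (P.filter (r · b)).card := fun b hb =>
    Nat.cast_pos.mpr (Finset.card_pos.mpr (hne b hb))
  have swap : ∀ H : α → ℝ, (∑ a ∈ P, H a) * w =
      ∑ b ∈ Q, ((P.filter (r · b)).card : ℝ)⁻¹ * ∑ a ∈ P with r a b, H a := by
    intro H
    simp_rw [Finset.sum_mul, Finset.mul_sum]
    rw [Finset.sum_congr rfl fun a ha => by rw [← hw a ha, Finset.mul_sum]]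
    rw [Finset.sum_comm' (t' := Q) (s' := fun b => P.filter (r · b))
      (by intro a b; simp only [Finset.mem_filter]; tauto)]
    exact Finset.sum_congr rfl fun b _ => Finset.sum_congr rfl fun a _ => mul_comm _ _
  have hcard : (P.card : ℝ) * w = Q.card := by
    have h := swap fun _ => 1
    simp only [Finset.sum_const, nsmul_eq_mul, mul_one] at h
    rw [h, Finset.sum_congr rfl fun b hb => inv_mul_cancel₀ (hpos b hb).ne']
    simp
  have hle : (∑ a ∈ P, F a) * w ≤ ∑ b ∈ Q, G b := by
    rw [swap]
    refine Finset.sum_le_sum fun b hb => ?_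
    rw [inv_mul_le_iff₀ (hpos b hb), ← nsmul_eq_mul]
    refine Finset.sum_le_card_nsmul _ _ _ fun a ha => ?_
    rw [Finset.mem_filter] at ha
    exact hFG a ha.1 b hb ha.2
  have hP0 : (0 : ℝ) < P.card := Nat.cast_pos.mpr hP.card_pos
  have hQ0 : (0 : ℝ) < Q.card := Nat.cast_pos.mpr hQ.card_pos
  rw [div_le_div_iff₀ hP0 hQ0, ← hcard]
  nlinarith

/-- The number of `l`-element sets between two sets `R` and `R ∪ N`. -/
theorem Finset.card_powersetCard_union_filter_subset {α : Type*} [DecidableEq α]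
    {R N : Finset α} (h : Disjoint R N) {l : ℕ} (hR : R.card ≤ l) :
    ((Finset.powersetCard l (R ∪ N)).filter (R ⊆ ·)).card = N.card.choose (l - R.card) := by
  rw [← Finset.card_powersetCard]
  symm
  refine Finset.card_bij' (fun A _ => R ∪ A) (fun T _ => T \ R) ?_ ?_ ?_ ?_
  · intro A hA
    rw [Finset.mem_powersetCard] at hA
    have hd : Disjoint R A := h.mono_right hA.1
    simp only [Finset.mem_filter, Finset.mem_powersetCard]
    refine ⟨⟨Finset.union_subset_union_right hA.1, ?_⟩, Finset.subset_union_left⟩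
    rw [Finset.card_union_of_disjoint hd]
    omega
  · intro T hT
    simp only [Finset.mem_filter, Finset.mem_powersetCard] at hT ⊢
    refine ⟨?_, by rw [Finset.card_sdiff_of_subset hT.2, hT.1.2]⟩
    exact sdiff_le_iff.mpr hT.1.1
  · intro A hA
    rw [Finset.mem_powersetCard] at hA
    exact Finset.union_sdiff_cancel_left (h.mono_right hA.1)
  · intro T hT
    simp only [Finset.mem_filter] at hT
    exact Finset.union_sdiff_of_subset hT.2

/-- If a set function does not decrease when some elements of an `l`-subset of `M` are replaced
by elements outside `M`, then its average over all `l`-sets is at least that over `l`-subsets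
of `M`. -/
theorem Finset.average_powersetCard_le_average_univ {α : Type*} [Fintype α] [DecidableEq α]
    (M : Finset α) (l : ℕ) (hl : l ≤ M.card) (F : Finset α → ℝ)
    (hF : ∀ T ⊆ M, T.card = l → ∀ s : Finset α, s.card = l → s ∩ M ⊆ T → F T ≤ F s) :
    (∑ T ∈ Finset.powersetCard l M, F T) / (M.card.choose l : ℝ) ≤
      (∑ s ∈ Finset.powersetCard l Finset.univ, F s) / ((Fintype.card α).choose l : ℝ) := by
  have hcount : ∀ R ⊆ M, R.card ≤ l → ((Finset.powersetCard l M).filter (R ⊆ ·)).card =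
      (M.card - R.card).choose (l - R.card) := by
    intro R hR hRl
    have h := Finset.card_powersetCard_union_filter_subset
      (Finset.disjoint_sdiff : Disjoint R (M \ R)) hRl
    rwa [Finset.union_sdiff_of_subset hR, Finset.card_sdiff_of_subset hR] at h
  have hinter : ∀ s : Finset α, s.card = l → (s ∩ M).card ≤ l := fun s hs =>
    (Finset.card_le_card Finset.inter_subset_left).trans hs.le
  have key := Finset.sum_div_card_le_of_uniform_mass (Finset.powersetCard l M)
    (Finset.powersetCard l Finset.univ) (fun T s => s ∩ M ⊆ T) F F
    (∑ k ∈ Finset.range (l + 1), l.choose k •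
      ((Mᶜ.card.choose (l - k) : ℝ) * ((M.card - k).choose (l - k) : ℝ)⁻¹))
    (Finset.powersetCard_nonempty.mpr hl)
    (Finset.powersetCard_nonempty.mpr (hl.trans (Finset.card_le_univ M))) ?_ ?_ ?_
  · simpa only [Finset.card_powersetCard, Finset.card_univ] using key
  · intro s hs
    have hsl := hinter s (Finset.mem_powersetCard.mp hs).2
    rw [← Finset.card_pos, hcount _ Finset.inter_subset_right hsl]
    exact Nat.choose_pos (by omega)
  · intro T hT
    obtain ⟨hTM, rfl⟩ := Finset.mem_powersetCard.mp hT
    rw [← Finset.sum_powerset_apply_card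
      (fun k => (Mᶜ.card.choose (T.card - k) : ℝ) * ((M.card - k).choose (T.card - k) : ℝ)⁻¹),
      ← Finset.sum_fiberwise_of_maps_to (g := fun s => s ∩ M) (t := T.powerset)
        (fun s hs => Finset.mem_powerset.mpr (Finset.mem_filter.mp hs).2)]
    refine Finset.sum_congr rfl fun R hR => ?_
    rw [Finset.mem_powerset] at hR
    have hRM := hR.trans hTM
    have hRl := Finset.card_le_card hR
    have hdisj : Disjoint R Mᶜ := disjoint_compl_right.mono_left hRM
    have hfiber : ((Finset.powersetCard T.card Finset.univ).filter (fun s => s ∩ M ⊆ T)).filter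
        (fun s => s ∩ M = R) = (Finset.powersetCard T.card (R ∪ Mᶜ)).filter (R ⊆ ·) := by
      ext s
      simp only [Finset.mem_filter, Finset.mem_powersetCard, Finset.subset_univ, true_and]
      constructor
      · rintro ⟨⟨hs, -⟩, rfl⟩
        refine ⟨⟨fun a ha => ?_, hs⟩, Finset.inter_subset_left⟩
        simp only [Finset.mem_union, Finset.mem_inter, Finset.mem_compl]
        tauto
      · rintro ⟨⟨hs, hc⟩, hRs⟩
        have he : s ∩ M = R := by
          refine Finset.Subset.antisymm (fun a ha => ?_) (Finset.subset_inter hRs hRM)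
          rw [Finset.mem_inter] at ha
          have := hs ha.1
          simp only [Finset.mem_union, Finset.mem_compl] at this
          tauto
        exact ⟨⟨hc, he.trans_subset hR⟩, he⟩
    rw [← Finset.card_powersetCard_union_filter_subset hdisj hRl, ← hfiber, ← nsmul_eq_mul]
    refine Finset.sum_eq_card_nsmul fun s hs => ?_
    rw [(Finset.mem_filter.mp hs).2, hcount R hRM hRl]
  · intro T hT s hs h
    rw [Finset.mem_powersetCard] at hT hs
    exact hF T hT.1 hT.2 s hs.2 h

/-- The value of the kernel `K` at the points indexed by the `l`-element set `s`, listed in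
increasing order. -/
noncomputable def kernelOn {Y : Type*} {l n : ℕ} (K : (Fin l → Y) → ℝ) (x : Fin n → Y)
    (s : Finset (Fin n)) : ℝ :=
  if h : s.card = l then K fun i => x (s.orderEmbOfFin h i) else 0

theorem ustatAvg_eq_sum_kernelOn {Y : Type*} (l : ℕ) (K : (Fin l → Y) → ℝ) (n : ℕ)
    (x : Fin n → Y) : ustatAvg l K n x =
      (∑ s ∈ Finset.powersetCard l Finset.univ, kernelOn K x s) / (n.choose l : ℝ) := by
  rw [ustatAvg, ← Finset.sum_attach (Finset.powersetCard l Finset.univ)]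
  congr 1
  refine Finset.sum_congr rfl fun s _ => ?_
  rw [kernelOn, dif_pos]

theorem kernelOn_eq_of_injective {Y : Type*} {l n : ℕ} {K : (Fin l → Y) → ℝ}
    (hKsym : ∀ (σ : Equiv.Perm (Fin l)) (u : Fin l → Y), K (u ∘ σ) = K u) (x : Fin n → Y)
    {s : Finset (Fin n)} (hs : s.card = l) {e : Fin l → Fin n} (he : Function.Injective e)
    (hes : ∀ i, e i ∈ s) : K (fun i => x (e i)) = kernelOn K x s := by
  rw [kernelOn, dif_pos hs]
  let e' : Fin l ≃ s := Equiv.ofBijective (fun i => ⟨e i, hes i⟩) <| by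
    rw [Fintype.bijective_iff_injective_and_card]
    exact ⟨fun i j h => he (congrArg Subtype.val h), by simp [hs]⟩
  rw [← hKsym (e'.trans (s.orderIsoOfFin hs).symm.toEquiv) fun i => x (s.orderEmbOfFin hs i)]
  congr 1
  funext i
  have : (s.orderEmbOfFin hs) ((s.orderIsoOfFin hs).symm (e' i)) = e i := by
    rw [← Finset.coe_orderIsoOfFin_apply, OrderIso.apply_symm_apply]
    rfl
  exact congrArg x this.symm

theorem kernelOn_map_castLE {Y : Type*} {l m n : ℕ} (h : m ≤ n) {K : (Fin l → Y) → ℝ}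
    (hKsym : ∀ (σ : Equiv.Perm (Fin l)) (u : Fin l → Y), K (u ∘ σ) = K u) (x : Fin n → Y)
    {s : Finset (Fin m)} (hs : s.card = l) :
    kernelOn K x (s.map (Fin.castLEEmb h)) = kernelOn K (fun i => x (Fin.castLE h i)) s := by
  have := kernelOn_eq_of_injective hKsym x (s := s.map (Fin.castLEEmb h))
    (by rw [Finset.card_map, hs])
    (e := fun i => Fin.castLE h (s.orderEmbOfFin hs i))
    ((Fin.castLE_injective h).comp (s.orderEmbOfFin hs).injective)
    (fun i => Finset.mem_map_of_mem (Fin.castLEEmb h) (s.orderEmbOfFin_mem hs i))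
  rw [← this, kernelOn, dif_pos hs]

/-- Concatenation of the increasing enumerations of two finite sets. -/
theorem exists_concat_enumeration {l k n : ℕ} (hk : k ≤ l) {A R : Finset (Fin n)}
    (hA : A.card = k) (hR : R.card = l - k) (hd : Disjoint A R) :
    let e : Fin l → Fin n := fun i => if h : (i : ℕ) < k then A.orderEmbOfFin hA ⟨i, h⟩
      else R.orderEmbOfFin hR ⟨i - k, by omega⟩
    Function.Injective e ∧ ∀ i, e i ∈ A ∪ R := by
  intro e
  refine ⟨fun i j hij => ?_, fun i => ?_⟩
  · simp only [e] at hij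
    split_ifs at hij with hi hj hj
    · simpa [Fin.ext_iff] using hij
    · exact absurd hij (Finset.disjoint_iff_ne.mp hd _ (A.orderEmbOfFin_mem hA _) _
        (R.orderEmbOfFin_mem hR _))
    · exact absurd hij.symm (Finset.disjoint_iff_ne.mp hd _ (A.orderEmbOfFin_mem hA _) _
        (R.orderEmbOfFin_mem hR _))
    · have := congrArg Fin.val ((R.orderEmbOfFin hR).injective hij)
      simp only at this
      exact Fin.ext (by omega)
  · simp only [e]
    split_ifs
    · exact Finset.mem_union_left _ (A.orderEmbOfFin_mem hA _)
    · exact Finset.mem_union_right _ (R.orderEmbOfFin_mem hR _)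

/-- Monotonicity of `U`-statistic averages under adding dominating points: if the added
points `x_m, …, x_{n-1}` dominate the kernel `K` in the sense that replacing any initial
block of arguments of `K` by any increasing selection of added points does not decrease
`K` on `𝒳`-valued arguments, then the `U`-statistic average over all `n` points is at
least the `U`-statistic average over the first `m` points. -/
theorem ustatAvg_mono_dominating {Y : Type*} [MetricSpace Y] (hdY : ∀ a b : Y, dist a b ≤ 1)
    (C : Set Y) (hC : IsCompact C) (l m n : ℕ) (hl : 0 < l) (hlm : l ≤ m) (hmn : m < n)
    (K : (Fin l → Y) → ℝ)
    (hK01 : ∀ u : Fin l → Y, K u ∈ Set.Icc (0 : ℝ) 1)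
    (hKsym : ∀ (σ : Equiv.Perm (Fin l)) (u : Fin l → Y), K (u ∘ σ) = K u)
    (x : Fin n → Y) (hxC : ∀ i : Fin n, (i : ℕ) < m → x i ∈ C)
    (hdom : ∀ k : ℕ, 1 ≤ k → k ≤ l → ∀ g : Fin k → Fin n, StrictMono g →
      (∀ j : Fin k, m ≤ (g j : ℕ)) → ∀ u : Fin l → Y, (∀ i, u i ∈ C) →
        K (fun i => if h : (i : ℕ) < k then x (g ⟨i, h⟩) else u i) ≥ K u) :
    ustatAvg l K m (fun i => x (Fin.castLE hmn.le i)) ≤ ustatAvg l K n x := by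
  set M : Finset (Fin n) := Finset.univ.map (Fin.castLEEmb hmn.le) with hM
  have hMlt : ∀ i, i ∈ M ↔ (i : ℕ) < m := by
    intro i
    simp only [hM, Finset.mem_map, Finset.mem_univ, true_and]
    exact ⟨by rintro ⟨j, rfl⟩; exact j.2, fun h => ⟨⟨i, h⟩, rfl⟩⟩
  have hMcard : M.card = m := by simp [hM]
  have hsum : ∑ s ∈ Finset.powersetCard l Finset.univ,
      kernelOn K (fun i => x (Fin.castLE hmn.le i)) s =
        ∑ T ∈ Finset.powersetCard l M, kernelOn K x T := by
    rw [hM, Finset.powersetCard_map, Finset.sum_map]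
    exact Finset.sum_congr rfl fun s hs =>
      (kernelOn_map_castLE hmn.le hKsym x (Finset.mem_powersetCard.mp hs).2).symm
  have key := Finset.average_powersetCard_le_average_univ M l (hMcard.symm ▸ hlm)
    (kernelOn K x) ?_
  · rwa [hMcard, Fintype.card_fin, ← hsum, ← ustatAvg_eq_sum_kernelOn,
      ← ustatAvg_eq_sum_kernelOn] at key
  intro T hTM hT s hs hsT
  have hsplit := Finset.card_sdiff_add_card_inter s M
  have hTR : (T \ (s ∩ M)).card = (s \ M).card := by
    rw [Finset.card_sdiff_of_subset hsT]; omega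
  obtain hk | hk := Nat.eq_zero_or_pos (s \ M).card
  · have hsub : s ⊆ M := Finset.sdiff_eq_empty_iff_subset.mp (Finset.card_eq_zero.mp hk)
    rw [Finset.inter_eq_left.mpr hsub] at hsT
    rw [Finset.eq_of_subset_of_card_le hsT (by omega)]
  have hkl : (s \ M).card ≤ l := by omega
  have hR : (s ∩ M).card = l - (s \ M).card := by omega
  obtain ⟨hinjT, hmemT⟩ := exists_concat_enumeration hkl hTR hR Finset.sdiff_disjoint
  obtain ⟨hinjs, hmems⟩ := exists_concat_enumeration hkl rfl hR
    (Finset.disjoint_sdiff_inter s M)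
  rw [Finset.sdiff_union_of_subset hsT] at hmemT
  rw [Finset.sdiff_union_inter] at hmems
  rw [← kernelOn_eq_of_injective hKsym x hT hinjT hmemT,
    ← kernelOn_eq_of_injective hKsym x hs hinjs hmems]
  refine (hdom _ hk hkl ((s \ M).orderEmbOfFin rfl) (OrderEmbedding.strictMono _)
    (fun j => ?_) _ fun i => hxC _ ((hMlt _).mp (hTM (hmemT i)))).le.trans_eq ?_
  · have := (Finset.mem_sdiff.mp ((s \ M).orderEmbOfFin_mem rfl j)).2
    rw [hMlt] at this
    omega
  · congr 1
    funext i
    split_ifs <;> rfl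
end

section
/- For every real λ ≥ 1.76: ∫₀¹ (1−s) · (2λs − 1 + (1 − λs) e^{−λs}) / (λ² s²) ds ≤ 2 ln λ / λ. -/
/-- The continuous extension to `ℝ` of `t ↦ (1 - e^{-t}) / t`. -/
noncomputable def einIntegrand : ℝ → ℝ := dslope (fun t => 1 - Real.exp (-t)) 0

/-- The complementary exponential integral `Ein x = ∫₀ˣ (1 - e^{-t}) / t dt`. -/
noncomputable def ein (x : ℝ) : ℝ := ∫ t in (0 : ℝ)..x, einIntegrand t

lemma einIntegrand_of_ne {t : ℝ} (ht : t ≠ 0) :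
    einIntegrand t = (1 - Real.exp (-t)) / t := by
  simp [einIntegrand, dslope_of_ne _ ht, slope_def_field]

lemma hasDerivAt_exp_neg (t : ℝ) : HasDerivAt (fun t => Real.exp (-t)) (-Real.exp (-t)) t := by
  simpa using (hasDerivAt_neg t).exp

lemma continuous_einIntegrand : Continuous einIntegrand := by
  rw [← continuousOn_univ]
  refine (continuousOn_dslope Filter.univ_mem).2 ⟨by fun_prop, ?_⟩
  exact ((hasDerivAt_exp_neg 0).differentiableAt.const_sub 1)

lemma hasDerivAt_ein (x : ℝ) : HasDerivAt ein (einIntegrand x) x :=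
  intervalIntegral.integral_hasDerivAt_right
    (continuous_einIntegrand.intervalIntegrable _ _)
    (continuous_einIntegrand.stronglyMeasurableAtFilter _ _)
    continuous_einIntegrand.continuousAt

lemma continuous_ein : Continuous ein :=
  continuous_iff_continuousAt.2 fun x => (hasDerivAt_ein x).continuousAt

lemma ein_zero : ein 0 = 0 := intervalIntegral.integral_same

lemma einIntegrand_zero : einIntegrand 0 = 1 := by
  rw [einIntegrand, dslope_same]
  simpa using ((hasDerivAt_exp_neg 0).const_sub 1).deriv

lemma ein_nonneg {x : ℝ} (hx : 0 ≤ x) : 0 ≤ ein x := by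
  refine intervalIntegral.integral_nonneg hx fun t ht => ?_
  rcases ht.1.eq_or_lt with rfl | h
  · simp [einIntegrand_zero]
  · rw [einIntegrand_of_ne h.ne']
    exact div_nonneg (by simpa using h.le) h.le

lemma taylor_five_le_exp_neg {t : ℝ} (ht : 0 ≤ t) :
    1 - t + t ^ 2 / 2 - t ^ 3 / 6 + t ^ 4 / 24 - t ^ 5 / 120 ≤ Real.exp (-t) := by
  have hd (x : ℝ) : HasDerivAt
      (fun x : ℝ => (1 - x + x ^ 2 / 2 - x ^ 3 / 6 + x ^ 4 / 24 - x ^ 5 / 120) * Real.exp x)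
      (-(x ^ 5 / 120) * Real.exp x) x := by
    have := (((((((hasDerivAt_id x).const_sub 1).add ((hasDerivAt_pow 2 x).div_const 2)).sub
      ((hasDerivAt_pow 3 x).div_const 6)).add ((hasDerivAt_pow 4 x).div_const 24)).sub
      ((hasDerivAt_pow 5 x).div_const 120))).mul (Real.hasDerivAt_exp x)
    refine this.congr_deriv ?_
    simp
    ring
  have hanti := antitoneOn_of_hasDerivWithinAt_nonpos (convex_Ici (0 : ℝ))
    (fun x _ => (hd x).continuousAt.continuousWithinAt)
    (fun x _ => (hd x).hasDerivWithinAt) (fun x hx => by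
      rw [interior_Ici, Set.mem_Ioi] at hx
      have := Real.exp_pos x
      have : 0 ≤ x ^ 5 / 120 * Real.exp x := by positivity
      linarith)
  have h := hanti (Set.mem_Ici.2 le_rfl) (Set.mem_Ici.2 ht) ht
  rw [Real.exp_neg, ← one_div, le_div_iff₀ (Real.exp_pos t)]
  simpa using h

lemma ein_le {x : ℝ} (hx : 0 ≤ x) :
    ein x ≤ x - x ^ 2 / 4 + x ^ 3 / 18 - x ^ 4 / 96 + x ^ 5 / 600 := by
  have hd (x : ℝ) : HasDerivAt
      (fun x : ℝ => x - x ^ 2 / 4 + x ^ 3 / 18 - x ^ 4 / 96 + x ^ 5 / 600 - ein x)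
      (1 - x / 2 + x ^ 2 / 6 - x ^ 3 / 24 + x ^ 4 / 120 - einIntegrand x) x := by
    have := ((((((hasDerivAt_id x).sub ((hasDerivAt_pow 2 x).div_const 4)).add
      ((hasDerivAt_pow 3 x).div_const 18)).sub ((hasDerivAt_pow 4 x).div_const 96)).add
      ((hasDerivAt_pow 5 x).div_const 600))).sub (hasDerivAt_ein x)
    refine this.congr_deriv ?_
    simp
    ring
  have hmono := monotoneOn_of_hasDerivWithinAt_nonneg (convex_Ici (0 : ℝ))
    (fun x _ => (hd x).continuousAt.continuousWithinAt)
    (fun x _ => (hd x).hasDerivWithinAt) (fun x hx => by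
      rw [interior_Ici, Set.mem_Ioi] at hx
      rw [einIntegrand_of_ne hx.ne', sub_nonneg, div_le_iff₀ hx]
      linarith [taylor_five_le_exp_neg hx.le])
  have h := hmono (Set.mem_Ici.2 le_rfl) (Set.mem_Ici.2 hx) hx
  simp only [ein_zero] at h
  norm_num at h
  linarith

/-- Closed form of the integral in terms of `ein`. -/
lemma integral_second_difference_eq {lam : ℝ} (hlam : 0 < lam)
    (hint : IntervalIntegrable (fun s : ℝ =>
      (1 - s) * (2 * lam * s - 1 + (1 - lam * s) * Real.exp (-(lam * s)))
        / (lam ^ 2 * s ^ 2)) MeasureTheory.volume 0 1) :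
    (∫ s in (0 : ℝ)..1,
        (1 - s) * (2 * lam * s - 1 + (1 - lam * s) * Real.exp (-(lam * s)))
          / (lam ^ 2 * s ^ 2)) =
      (2 * (1 - Real.exp (-lam)) / lam - 3 + (2 + 1 / lam) * ein lam) / lam := by
  have hein (s : ℝ) : HasDerivAt (fun s => ein (lam * s)) (einIntegrand (lam * s) * lam) s := by
    simpa [Function.comp_def] using
      (hasDerivAt_ein (lam * s)).comp s ((hasDerivAt_id s).const_mul lam)
  have hexp (s : ℝ) :
      HasDerivAt (fun s => Real.exp (-(lam * s))) (-Real.exp (-(lam * s)) * lam) s := by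
    simpa [Function.comp_def] using
      (hasDerivAt_exp_neg (lam * s)).comp s ((hasDerivAt_id s).const_mul lam)
  have hquot (s : ℝ) (hs : 0 < s) : HasDerivAt (fun s => einIntegrand (lam * s))
      ((Real.exp (-(lam * s)) * lam * (lam * s) - (1 - Real.exp (-(lam * s))) * lam)
        / (lam * s) ^ 2) s := by
    have h := ((hexp s).const_sub 1).div ((hasDerivAt_id s).const_mul lam)
      (mul_pos hlam hs).ne'
    refine (h.congr_of_eventuallyEq ?_).congr_deriv (by simp)
    filter_upwards [lt_mem_nhds hs] with r hr
    simpa using einIntegrand_of_ne (mul_pos hlam hr).ne'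
  have hc : Continuous fun s : ℝ => (einIntegrand (lam * s) + 2 * ein (lam * s)) / lam
      - (2 * (lam * s) - ein (lam * s) + Real.exp (-(lam * s))) / lam ^ 2 := by
    have := continuous_ein
    have := continuous_einIntegrand
    fun_prop
  rw [intervalIntegral.integral_eq_sub_of_hasDerivAt_of_le zero_le_one hc.continuousOn ?_ hint]
  · simp only [mul_one, mul_zero, ein_zero, einIntegrand_zero, einIntegrand_of_ne hlam.ne']
    field_simp
    simp
    ring
  · intro s hs
    have h := (((hquot s hs.1).add ((hein s).const_mul 2)).div_const lam).sub
      ((((((hasDerivAt_id s).const_mul lam).const_mul 2).sub (hein s)).add (hexp s)).div_const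
        (lam ^ 2))
    refine h.congr_deriv ?_
    rw [einIntegrand_of_ne (mul_pos hlam hs.1).ne']
    have := hs.1.ne'
    field_simp
    ring

lemma monotoneOn_two_log_sub :
    MonotoneOn (fun x : ℝ => 2 * Real.log x
      - (2 * (1 - Real.exp (-x)) / x - 3 + (2 + 1 / x) * ein x)) (Set.Ioi 0) := by
  have hd (x : ℝ) (hx : 0 < x) : HasDerivAt (fun x : ℝ => 2 * Real.log x
      - (2 * (1 - Real.exp (-x)) / x - 3 + (2 + 1 / x) * ein x))
      ((ein x + (1 - Real.exp (-x))) / x ^ 2) x := by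
    have h := ((Real.hasDerivAt_log hx.ne').const_mul 2).sub
      ((((((hasDerivAt_exp_neg x).const_sub 1).const_mul 2).div (hasDerivAt_id x) hx.ne').sub_const
        3).add ((((hasDerivAt_const x (1 : ℝ)).div (hasDerivAt_id x) hx.ne').const_add 2).mul
          (hasDerivAt_ein x)))
    refine h.congr_deriv ?_
    rw [einIntegrand_of_ne hx.ne']
    simp only [id, Pi.div_apply]
    field_simp
    ring
  refine monotoneOn_of_hasDerivWithinAt_nonneg (convex_Ioi 0)
    (fun x hx => (hd x hx).continuousAt.continuousWithinAt)
    (fun x hx => (hd x (interior_subset hx)).hasDerivWithinAt) fun x hx => ?_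
  have hx : 0 < x := interior_subset hx
  have h1 : Real.exp (-x) ≤ 1 := by simpa using hx.le
  exact div_nonneg (by linarith [ein_nonneg hx.le]) (by positivity)

lemma log_lower_bound : (0.56 : ℝ) ≤ Real.log 1.76 := by
  rw [Real.le_log_iff_exp_le (by norm_num)]
  refine (Real.exp_bound' (n := 5) (by norm_num) (by norm_num) (by norm_num)).trans ?_
  norm_num [Finset.sum_range_succ, Nat.factorial]

/-- For every real `λ ≥ 1.76`:
`∫₀¹ (1-s) (2λs - 1 + (1-λs) e^{-λs}) / (λ² s²) ds ≤ 2 ln λ / λ`. -/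
theorem integral_second_difference_bound (lam : ℝ) (hlam : 1.76 ≤ lam) :
    (∫ s in (0 : ℝ)..1,
        (1 - s) * (2 * lam * s - 1 + (1 - lam * s) * Real.exp (-(lam * s)))
          / (lam ^ 2 * s ^ 2)) ≤
      2 * Real.log lam / lam := by
  have hpos : 0 < lam := lt_of_lt_of_le (by norm_num) hlam
  by_cases hint : IntervalIntegrable (fun s : ℝ =>
      (1 - s) * (2 * lam * s - 1 + (1 - lam * s) * Real.exp (-(lam * s)))
        / (lam ^ 2 * s ^ 2)) MeasureTheory.volume 0 1
  · rw [integral_second_difference_eq hpos hint]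
    gcongr
    have hmono := monotoneOn_two_log_sub (Set.mem_Ioi.2 (by norm_num : (0 : ℝ) < 1.76))
      (Set.mem_Ioi.2 hpos) hlam
    have h1 := ein_le (x := 1.76) (by norm_num)
    have h2 := taylor_five_le_exp_neg (t := 1.76) (by norm_num)
    have h3 := log_lower_bound
    rw [one_div]
    norm_num at hmono h1 h2 h3
    linarith
  · rw [intervalIntegral.integral_undef hint]
    have := Real.log_nonneg (le_trans (by norm_num) hlam)
    positivity
end

section
/- For any 1-Lipschitz function g : 𝒳 → [0,1] (i.e. |g(x) − g(y)| ≤ d₀(x,y) for all x, y ∈ 𝒳) and any constant c ∈ [0,1], the function f : 𝔑 → [0,1] defined by f(ξ) := (1/|ξ|) ∫_𝒳 g dξ for ξ ≠ 0 and f(0) := c satisfies |f(ξ) − f(η)| ≤ d̄₁(ξ,η) for all ξ, η ∈ 𝔑, i.e. f ∈ F̄₂. -/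
open scoped BigOperators

/-- Replacing the sum of `g` over `xs` by the sum over a longer list `ys` costs at most the
matching cost, up to a remainder bounded by the number of unmatched points. -/
theorem exists_remainder_zipWith_dist {S : Type*} [PseudoMetricSpace S] (g : S → ℝ)
    (hg01 : ∀ x, g x ∈ Set.Icc (0 : ℝ) 1) (hglip : ∀ x y : S, |g x - g y| ≤ dist x y)
    (xs ys : List S) (h : xs.length ≤ ys.length) :
    ∃ R : ℝ, 0 ≤ R ∧ R ≤ (ys.length : ℝ) - xs.length ∧
      |(xs.map g).sum + R - (ys.map g).sum| ≤ (List.zipWith dist xs ys).sum := by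
  induction xs generalizing ys with
  | nil =>
    refine ⟨(ys.map g).sum, ?_, ?_, by simp⟩
    · exact List.sum_nonneg (by simpa using fun x _ => (hg01 x).1)
    · have := List.sum_le_card_nsmul (ys.map g) 1 (by simpa using fun x _ => (hg01 x).2)
      simpa using this
  | cons x xs ih =>
    cases ys with
    | nil => simp at h
    | cons y ys =>
      obtain ⟨R, hR0, hR1, hR⟩ := ih ys (by simpa using h)
      refine ⟨R, hR0, by push_cast [List.length_cons]; linarith, ?_⟩
      simp only [List.map_cons, List.sum_cons, List.zipWith_cons_cons]
      have hxy := abs_le.mp (hglip x y)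
      have hR' := abs_le.mp hR
      exact abs_le.mpr ⟨by linarith [hxy.1, hR'.1], by linarith [hxy.2, hR'.2]⟩

/-- If `a, b ∈ [0,1]` are averages of `g` over lists `xs` and `ys` with `ys` at least as long as
`xs`, then `|a - b|` is controlled by the matching cost and the number of unmatched points. -/
theorem abs_sub_mul_length_le {S : Type*} [PseudoMetricSpace S] (g : S → ℝ)
    (hg01 : ∀ x, g x ∈ Set.Icc (0 : ℝ) 1) (hglip : ∀ x y : S, |g x - g y| ≤ dist x y)
    (xs ys : List S) (h : xs.length ≤ ys.length) {a b : ℝ} (ha : a ∈ Set.Icc (0 : ℝ) 1)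
    (hax : a * xs.length = (xs.map g).sum) (hby : b * ys.length = (ys.map g).sum) :
    |a - b| * ys.length ≤
      (List.zipWith dist xs ys).sum + ((ys.length : ℝ) - xs.length) := by
  obtain ⟨R, hR0, hR1, hR⟩ := exists_remainder_zipWith_dist g hg01 hglip xs ys h
  have hlen : (xs.length : ℝ) ≤ ys.length := by exact_mod_cast h
  have h0 : 0 ≤ a * ((ys.length : ℝ) - xs.length) := mul_nonneg ha.1 (by linarith)
  have h1 : a * ((ys.length : ℝ) - xs.length) ≤ (ys.length : ℝ) - xs.length :=
    mul_le_of_le_one_left (by linarith) ha.2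
  have hR' := abs_le.mp hR
  rw [← abs_of_nonneg (Nat.cast_nonneg (α := ℝ) ys.length), ← abs_mul,
    abs_of_nonneg (Nat.cast_nonneg (α := ℝ) ys.length)]
  exact abs_le.mpr ⟨by linarith [hR'.1], by linarith [hR'.2]⟩

/-- For any 1-Lipschitz `g : 𝒳 → [0,1]` and any `c ∈ [0,1]`, the normalized sample mean
`f(ξ) = (1/|ξ|) ∫ g dξ` (with `f(0) = c`) is `[0,1]`-valued and `d̄₁`-Lipschitz with
constant 1, i.e. `f ∈ F̄₂`. -/
theorem sample_mean_mem_Fbar2 {S : Type*} [MetricSpace S] [CompactSpace S]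
    (hd : ∀ x y : S, dist x y ≤ 1)
    (g : S → ℝ) (hg01 : ∀ x, g x ∈ Set.Icc (0 : ℝ) 1)
    (hglip : ∀ x y : S, |g x - g y| ≤ dist x y)
    (c : ℝ) (hc : c ∈ Set.Icc (0 : ℝ) 1)
    (f : Multiset S → ℝ) (hf0 : f 0 = c)
    (hf : ∀ ξ : Multiset S, ξ ≠ 0 → f ξ = (ξ.map g).sum / (ξ.card : ℝ)) :
    (∀ ξ : Multiset S, f ξ ∈ Set.Icc (0 : ℝ) 1) ∧
    ∀ ξ η : Multiset S, |f ξ - f η| ≤ dbar1 dist ξ η := by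
  have hmul (ξ : Multiset S) : f ξ * ξ.card = (ξ.map g).sum := by
    rcases eq_or_ne ξ 0 with rfl | hξ
    · simp
    · have : (ξ.card : ℝ) ≠ 0 := by simpa using hξ
      rw [hf ξ hξ, div_mul_cancel₀ _ this]
  have hf01 (ξ : Multiset S) : f ξ ∈ Set.Icc (0 : ℝ) 1 := by
    rcases eq_or_ne ξ 0 with rfl | hξ
    · rwa [hf0]
    · rw [hf ξ hξ]
      refine ⟨div_nonneg (Multiset.sum_nonneg ?_) (Nat.cast_nonneg _),
        div_le_one_of_le₀ ?_ (Nat.cast_nonneg _)⟩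
      · simpa using fun x _ => (hg01 x).1
      · have := Multiset.sum_le_card_nsmul (ξ.map g) 1 (by simpa using fun x _ => (hg01 x).2)
        simpa using this
  refine ⟨hf01, fun ξ η => ?_⟩
  unfold dbar1
  split_ifs with h0
  · simp [h0.1, h0.2]
  have hpos : 0 < ((max ξ.card η.card : ℕ) : ℝ) := by
    rw [Nat.cast_pos, lt_max_iff, Multiset.card_pos, Multiset.card_pos]
    tauto
  rw [le_div_iff₀ hpos, ← sub_le_iff_le_add]
  refine le_csInf ⟨_, ξ.toList, η.toList, ξ.coe_toList, η.coe_toList, rfl⟩ ?_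
  rintro _ ⟨xs, ys, rfl, rfl, rfl⟩
  have hx := hmul (xs : Multiset S)
  have hy := hmul (ys : Multiset S)
  simp only [Multiset.coe_card, Multiset.map_coe, Multiset.sum_coe] at hx hy ⊢
  rw [sub_le_iff_le_add]
  rcases le_total xs.length ys.length with h | h
  · rw [max_eq_right h, min_eq_left h]
    exact abs_sub_mul_length_le g hg01 hglip xs ys h (hf01 _) hx hy
  · rw [max_eq_left h, min_eq_right h, abs_sub_comm,
      List.zipWith_comm_of_comm (fun x y => dist_comm x y)]
    exact abs_sub_mul_length_le g hg01 hglip ys xs h (hf01 _) hy hx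
end

section
/- Relative Wasserstein distance between Poisson distributions: let 0 < μ ≤ ν, let M ∼ Poisson(μ) and K ∼ Poisson(ν − μ) be independent ℤ₊-valued random variables, and set N := M + K (so N ∼ Poisson(ν)). Then E[ d_R(M, N) ] = ((ν − μ)/ν) · (1 − e^{−ν}) ≤ (ν − μ)/ν. In particular, d_RW( Poisson(μ), Poisson(ν) ) ≤ |μ − ν| / max(μ, ν) for all μ, ν > 0. -/
open scoped BigOperators

open scoped Classical in
/-- The relative difference metric on `ℤ₊`: `d_R(m,n) = |m - n| / max(m,n)`, `d_R(0,0) = 0`. -/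
noncomputable def dR (m n : ℕ) : ℝ :=
  if max m n = 0 then 0 else |(m : ℝ) - (n : ℝ)| / ((max m n : ℕ) : ℝ)

/-- The Wasserstein metric `d_RW` with respect to `d_R` between probability
distributions on `ℤ₊`: the infimum over couplings of the expected
relative difference. -/
noncomputable def dRW (μ ν : MeasureTheory.Measure ℕ) : ℝ :=
  sInf {r : ℝ | ∃ ρ : MeasureTheory.Measure (ℕ × ℕ),
    MeasureTheory.IsProbabilityMeasure ρ ∧
    ρ.map Prod.fst = μ ∧ ρ.map Prod.snd = ν ∧
    r = ∫ p : ℕ × ℕ, dR p.1 p.2 ∂ρ}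

open MeasureTheory ProbabilityTheory
open scoped NNReal

lemma dR_nonneg (m n : ℕ) : 0 ≤ dR m n := by
  unfold dR
  split_ifs <;> positivity

lemma dR_comm (m n : ℕ) : dR m n = dR n m := by
  simp only [dR, max_comm m n, abs_sub_comm (m : ℝ) n]

lemma dR_add_right (m k : ℕ) : dR m (m + k) = k * ((m + k : ℕ) : ℝ)⁻¹ := by
  unfold dR
  rw [max_eq_right (Nat.le_add_right m k)]
  split_ifs with h
  · simp [h]
  · simp [div_eq_mul_inv]

lemma dR_add_right_le_one (m k : ℕ) : dR m (m + k) ≤ 1 := by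
  rw [dR_add_right, ← div_eq_mul_inv]
  exact div_le_one_of_le₀ (by push_cast; linarith [m.cast_nonneg (α := ℝ)]) (by positivity)

/-- The Chen-Stein identity for the Poisson distribution. -/
lemma integral_natCast_mul_poissonMeasure (r : ℝ≥0) (g : ℕ → ℝ) :
    ∫ n, (n : ℝ) * g n ∂poissonMeasure r = r * ∫ n, g (n + 1) ∂poissonMeasure r := by
  rw [integral_poissonMeasure, integral_poissonMeasure, ← tsum_mul_left,
    ← Nat.succ_injective.tsum_eq]
  · refine tsum_congr fun n ↦ ?_
    simp only [Nat.succ_eq_add_one, Nat.factorial_succ, smul_eq_mul]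
    have : (n.factorial : ℝ) ≠ 0 := by positivity
    push_cast
    field_simp
    ring
  · intro n hn
    cases n with
    | zero => simp at hn
    | succ n => exact ⟨n, rfl⟩

lemma integral_inv_add_one_poissonMeasure (r : ℝ≥0) :
    r * ∫ n : ℕ, ((n + 1 : ℕ) : ℝ)⁻¹ ∂poissonMeasure r = 1 - Real.exp (-r) := by
  rw [← integral_natCast_mul_poissonMeasure r fun n ↦ (n : ℝ)⁻¹]
  have h (n : ℕ) : (n : ℝ) * (n : ℝ)⁻¹ = ({0}ᶜ : Set ℕ).indicator 1 n := by
    by_cases hn : n = 0 <;> simp [hn]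
  simp_rw [h]
  rw [integral_indicator_one .of_discrete, probReal_compl_eq_one_sub .of_discrete,
    poissonMeasure_real_singleton]
  simp

lemma integral_dR_prod_poissonMeasure (a r : ℝ≥0) (h : a + r ≠ 0) :
    ∫ p : ℕ × ℕ, dR p.1 (p.1 + p.2) ∂(poissonMeasure a).prod (poissonMeasure r) =
      (r : ℝ) / (a + r : ℝ≥0) * (1 - Real.exp (-(a + r : ℝ≥0))) := by
  have hdR_int : Integrable (fun p : ℕ × ℕ ↦ dR p.1 (p.1 + p.2))
      ((poissonMeasure a).prod (poissonMeasure r)) :=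
    .of_bound (Measurable.of_discrete.aestronglyMeasurable) 1 <| ae_of_all _ fun p ↦ by
      rw [Real.norm_of_nonneg (dR_nonneg _ _)]
      exact dR_add_right_le_one _ _
  have hinv_int : Integrable (fun p : ℕ × ℕ ↦ ((p.1 + p.2 + 1 : ℕ) : ℝ)⁻¹)
      ((poissonMeasure a).prod (poissonMeasure r)) :=
    .of_bound (Measurable.of_discrete.aestronglyMeasurable) 1 <| ae_of_all _ fun p ↦ by
      rw [Real.norm_of_nonneg (by positivity)]
      exact Nat.cast_inv_le_one _
  have hconv : ∫ p : ℕ × ℕ, ((p.1 + p.2 + 1 : ℕ) : ℝ)⁻¹ ∂(poissonMeasure a).prod (poissonMeasure r)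
      = ∫ n : ℕ, ((n + 1 : ℕ) : ℝ)⁻¹ ∂poissonMeasure (a + r) := by
    rw [← poissonMeasure_conv_poissonMeasure, Measure.conv, integral_map
      (Measurable.of_discrete.aemeasurable) (Measurable.of_discrete.aestronglyMeasurable)]
  have hne : ((a + r : ℝ≥0) : ℝ) ≠ 0 := by exact_mod_cast h
  rw [← integral_inv_add_one_poissonMeasure, ← hconv, integral_prod _ hdR_int,
    integral_prod _ hinv_int]
  simp_rw [dR_add_right]
  have hstein (m : ℕ) := integral_natCast_mul_poissonMeasure r fun k ↦ ((m + k : ℕ) : ℝ)⁻¹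
  simp_rw [hstein, integral_const_mul, ← add_assoc]
  field_simp

lemma dRW_comm (μ ν : Measure ℕ) : dRW μ ν = dRW ν μ := by
  suffices h : ∀ (μ ν : Measure ℕ) (r : ℝ),
      (∃ ρ : Measure (ℕ × ℕ), IsProbabilityMeasure ρ ∧ ρ.map Prod.fst = μ ∧
        ρ.map Prod.snd = ν ∧ r = ∫ p : ℕ × ℕ, dR p.1 p.2 ∂ρ) →
      ∃ ρ : Measure (ℕ × ℕ), IsProbabilityMeasure ρ ∧ ρ.map Prod.fst = ν ∧
        ρ.map Prod.snd = μ ∧ r = ∫ p : ℕ × ℕ, dR p.1 p.2 ∂ρ by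
    unfold dRW
    congr 1
    ext r
    exact ⟨h μ ν r, h ν μ r⟩
  rintro μ ν r ⟨ρ, hρ, hfst, hsnd, rfl⟩
  refine ⟨ρ.map Prod.swap, Measure.isProbabilityMeasure_map measurable_swap.aemeasurable, ?_, ?_, ?_⟩
  · rwa [Measure.map_map measurable_fst measurable_swap]
  · rwa [Measure.map_map measurable_snd measurable_swap]
  · rw [integral_map measurable_swap.aemeasurable (Measurable.of_discrete.aestronglyMeasurable)]
    simp [dR_comm]

lemma dRW_le_integral {μ ν : Measure ℕ} (ρ : Measure (ℕ × ℕ)) [IsProbabilityMeasure ρ]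
    (hfst : ρ.map Prod.fst = μ) (hsnd : ρ.map Prod.snd = ν) :
    dRW μ ν ≤ ∫ p : ℕ × ℕ, dR p.1 p.2 ∂ρ := by
  refine csInf_le ⟨0, ?_⟩ ⟨ρ, inferInstance, hfst, hsnd, rfl⟩
  rintro _ ⟨ρ', -, -, -, rfl⟩
  exact integral_nonneg fun p ↦ dR_nonneg _ _

lemma div_mul_one_sub_exp_neg_le {x y : ℝ} (z : ℝ) (hx : 0 ≤ x) (hy : 0 ≤ y) :
    x / y * (1 - Real.exp (-z)) ≤ x / y :=
  mul_le_of_le_one_right (div_nonneg hx hy) (by linarith [Real.exp_pos (-z)])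

lemma dRW_poissonMeasure_add_le (a r : ℝ≥0) (h : a + r ≠ 0) :
    dRW (poissonMeasure a) (poissonMeasure (a + r)) ≤ (r : ℝ) / (a + r : ℝ≥0) := by
  have hmeas : Measurable fun p : ℕ × ℕ ↦ (p.1, p.1 + p.2) := .of_discrete
  let ρ := ((poissonMeasure a).prod (poissonMeasure r)).map fun p ↦ (p.1, p.1 + p.2)
  have : IsProbabilityMeasure ρ := Measure.isProbabilityMeasure_map hmeas.aemeasurable
  have hfst : ρ.map Prod.fst = poissonMeasure a := by
    rw [Measure.map_map measurable_fst hmeas]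
    exact measurePreserving_fst.map_eq
  have hsnd : ρ.map Prod.snd = poissonMeasure (a + r) := by
    rw [Measure.map_map measurable_snd hmeas, ← poissonMeasure_conv_poissonMeasure]
    rfl
  calc dRW (poissonMeasure a) (poissonMeasure (a + r))
      ≤ ∫ p : ℕ × ℕ, dR p.1 p.2 ∂ρ := dRW_le_integral ρ hfst hsnd
    _ = (r : ℝ) / (a + r : ℝ≥0) * (1 - Real.exp (-(a + r : ℝ≥0))) := by
      rw [integral_map hmeas.aemeasurable (Measurable.of_discrete.aestronglyMeasurable),
        integral_dR_prod_poissonMeasure a r h]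
    _ ≤ (r : ℝ) / (a + r : ℝ≥0) := div_mul_one_sub_exp_neg_le _ r.2 (a + r).2

lemma dRW_poissonMeasure_le_of_le {a b : ℝ≥0} (hb : 0 < b) (hab : a ≤ b) :
    dRW (poissonMeasure a) (poissonMeasure b) ≤
      |(a : ℝ) - (b : ℝ)| / max (a : ℝ) (b : ℝ) := by
  obtain ⟨r, rfl⟩ := exists_add_of_le hab
  convert dRW_poissonMeasure_add_le a r hb.ne' using 2
  · simp
  · exact max_eq_right (by exact_mod_cast hab)

/-- Relative Wasserstein distance between Poisson distributions: if `M ∼ Poisson(μ)` and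
`K ∼ Poisson(ν-μ)` are independent (`0 < μ ≤ ν`) and `N := M + K` (so `N ∼ Poisson(ν)`),
then `E d_R(M,N) = ((ν-μ)/ν)(1 - e^{-ν}) ≤ (ν-μ)/ν`; in particular
`d_RW(Poisson(μ), Poisson(ν)) ≤ |μ-ν|/max(μ,ν)` for all `μ, ν > 0`. -/
theorem dRW_poisson_bound {Ω : Type*} [MeasurableSpace Ω] (P : Measure Ω)
    [IsProbabilityMeasure P] (μ ν : ℝ≥0) (hμ : 0 < μ) (hμν : μ ≤ ν)
    (M K : Ω → ℕ) (hM : Measurable M) (hK : Measurable K)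
    (hMdist : P.map M = poissonMeasure μ) (hKdist : P.map K = poissonMeasure (ν - μ))
    (hindep : IndepFun M K P) :
    (∫ ω, dR (M ω) (M ω + K ω) ∂P) =
        (((ν : ℝ) - (μ : ℝ)) / (ν : ℝ)) * (1 - Real.exp (-(ν : ℝ))) ∧
    (((ν : ℝ) - (μ : ℝ)) / (ν : ℝ)) * (1 - Real.exp (-(ν : ℝ))) ≤
        ((ν : ℝ) - (μ : ℝ)) / (ν : ℝ) ∧
    ∀ a b : ℝ≥0, 0 < a → 0 < b →
      dRW (poissonMeasure a) (poissonMeasure b) ≤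
        |(a : ℝ) - (b : ℝ)| / max (a : ℝ) (b : ℝ) := by
  have hν : μ + (ν - μ) = ν := add_tsub_cancel_of_le hμν
  have hjoint : P.map (fun ω ↦ (M ω, K ω)) =
      (poissonMeasure μ).prod (poissonMeasure (ν - μ)) := by
    rw [(indepFun_iff_map_prod_eq_prod_map_map hM.aemeasurable hK.aemeasurable).1 hindep,
      hMdist, hKdist]
  refine ⟨?_, div_mul_one_sub_exp_neg_le _ (sub_nonneg.2 (by exact_mod_cast hμν)) ν.2,
    fun a b ha hb ↦ ?_⟩
  · have h := integral_dR_prod_poissonMeasure μ (ν - μ) (by rw [hν]; exact (hμ.trans_le hμν).ne')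
    rw [hν, NNReal.coe_sub hμν, ← hjoint, integral_map (hM.prodMk hK).aemeasurable
      (Measurable.of_discrete.aestronglyMeasurable)] at h
    exact h
  · rcases le_total a b with hab | hab
    · exact dRW_poissonMeasure_le_of_le hb hab
    · rw [dRW_comm, abs_sub_comm, max_comm]
      exact dRW_poissonMeasure_le_of_le ha hab
end

section
/- For every real λ > 0: ∫₀¹ (1 − e^{−λs}) / (λs) ds ≤ min( 1, (0.95 + max(ln λ, 0)) / λ ). -/
lemma one_sub_exp_neg_div_nonneg {t : ℝ} (ht : 0 ≤ t) : 0 ≤ (1 - Real.exp (-t)) / t :=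
  div_nonneg (sub_nonneg.2 (Real.exp_le_one_iff.2 (by linarith))) ht

lemma one_sub_exp_neg_div_le_one {t : ℝ} (ht : 0 ≤ t) : (1 - Real.exp (-t)) / t ≤ 1 :=
  div_le_one_of_le₀ (by linarith [Real.add_one_le_exp (-t)]) ht

lemma one_sub_exp_neg_div_le {t : ℝ} (ht : 0 ≤ t) (ht2 : t ≤ 2) :
    (1 - Real.exp (-t)) / t ≤ 1 - t / 4 := by
  rcases ht.eq_or_lt with rfl | hpos
  · norm_num
  · have h : 1 - t / 2 ≤ Real.exp (-(t / 2)) := by linarith [Real.add_one_le_exp (-(t / 2))]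
    have hsq : Real.exp (-t) = Real.exp (-(t / 2)) ^ 2 := by
      rw [← Real.exp_nat_mul]
      congr 1
      push_cast
      ring
    have hle : (1 - t / 2) ^ 2 ≤ Real.exp (-t) := by
      rw [hsq]
      exact pow_le_pow_left₀ (by linarith) h 2
    rw [div_le_iff₀ hpos]
    nlinarith

lemma intervalIntegrable_one_sub_exp_neg_div {a b : ℝ} (ha : 0 ≤ a) (hb : 0 ≤ b) :
    IntervalIntegrable (fun t : ℝ => (1 - Real.exp (-t)) / t) MeasureTheory.volume a b := by
  refine (intervalIntegrable_const (c := (1 : ℝ))).mono_fun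
    (Measurable.aestronglyMeasurable (by fun_prop)) ?_
  refine (MeasureTheory.ae_restrict_iff' measurableSet_uIoc).2 (Filter.Eventually.of_forall ?_)
  intro t ht
  have ht0 : 0 ≤ t := (le_min ha hb).trans ht.1.le
  beta_reduce
  rw [Real.norm_of_nonneg (one_sub_exp_neg_div_nonneg ht0), norm_one]
  exact one_sub_exp_neg_div_le_one ht0

lemma integral_one_sub_exp_neg_div_le_self {x : ℝ} (hx : 0 ≤ x) :
    ∫ t in (0 : ℝ)..x, (1 - Real.exp (-t)) / t ≤ x := by
  have h := intervalIntegral.integral_mono_on hx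
    (intervalIntegrable_one_sub_exp_neg_div le_rfl hx)
    (intervalIntegrable_const (c := (1 : ℝ)))
    (fun t ht => one_sub_exp_neg_div_le_one ht.1)
  simpa using h

lemma integral_one_sub_exp_neg_div_le_of_le_two {x : ℝ} (hx : 0 ≤ x) (hx2 : x ≤ 2) :
    ∫ t in (0 : ℝ)..x, (1 - Real.exp (-t)) / t ≤ x - x ^ 2 / 8 := by
  have h := intervalIntegral.integral_mono_on hx
    (intervalIntegrable_one_sub_exp_neg_div le_rfl hx)
    (Continuous.intervalIntegrable (by fun_prop) 0 x)
    (fun t ht => one_sub_exp_neg_div_le ht.1 (ht.2.trans hx2))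
  have hint : ∫ t in (0 : ℝ)..x, (1 - t / 4) = x - x ^ 2 / 8 := by
    rw [intervalIntegral.integral_sub (by simp)
      (Continuous.intervalIntegrable (by fun_prop) 0 x), intervalIntegral.integral_div]
    simp
    ring
  exact h.trans hint.le

lemma integral_one_sub_exp_neg_div_le_log {x : ℝ} (hx : 1 ≤ x) :
    ∫ t in (1 : ℝ)..x, (1 - Real.exp (-t)) / t ≤ Real.log x := by
  have hx0 : 0 < x := one_pos.trans_le hx
  have hmem : (0 : ℝ) ∉ Set.uIcc 1 x := Set.notMem_uIcc_of_lt one_pos hx0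
  have h := intervalIntegral.integral_mono_on hx
    (intervalIntegrable_one_sub_exp_neg_div zero_le_one hx0.le)
    (intervalIntegral.intervalIntegrable_one_div (fun t ht h0 => hmem (h0 ▸ ht))
      continuousOn_id)
    (fun t ht => div_le_div_of_nonneg_right
      (by linarith [Real.exp_pos (-t)] : 1 - Real.exp (-t) ≤ 1) (zero_le_one.trans ht.1))
  have hint : ∫ t in (1 : ℝ)..x, 1 / t = Real.log x := by
    rw [integral_one_div hmem, div_one]
  exact h.trans hint.le

lemma integral_one_sub_exp_neg_div_le_add_log {x : ℝ} (hx : 0 ≤ x) :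
    ∫ t in (0 : ℝ)..x, (1 - Real.exp (-t)) / t ≤ 7 / 8 + max (Real.log x) 0 := by
  rcases le_total x 1 with h1 | h1
  · have := integral_one_sub_exp_neg_div_le_of_le_two hx (by linarith)
    nlinarith [le_max_right (Real.log x) 0]
  · rw [← intervalIntegral.integral_add_adjacent_intervals
      (intervalIntegrable_one_sub_exp_neg_div le_rfl zero_le_one)
      (intervalIntegrable_one_sub_exp_neg_div zero_le_one hx)]
    have := integral_one_sub_exp_neg_div_le_of_le_two zero_le_one one_le_two
    linarith [integral_one_sub_exp_neg_div_le_log h1, le_max_left (Real.log x) 0]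

/-- For every real `λ > 0`:
`∫₀¹ (1 - e^{-λs}) / (λs) ds ≤ min(1, (0.95 + ln⁺ λ) / λ)`. -/
theorem integral_first_difference_bound (lam : ℝ) (hlam : 0 < lam) :
    (∫ s in (0 : ℝ)..1, (1 - Real.exp (-(lam * s))) / (lam * s)) ≤
      min 1 ((0.95 + max (Real.log lam) 0) / lam) := by
  rw [intervalIntegral.integral_comp_mul_left (fun t => (1 - Real.exp (-t)) / t) hlam.ne',
    mul_zero, mul_one, smul_eq_mul, inv_mul_eq_div]
  refine le_min (div_le_one_of_le₀ (integral_one_sub_exp_neg_div_le_self hlam.le) hlam.le)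
    (div_le_div_of_nonneg_right ?_ hlam.le)
  have := integral_one_sub_exp_neg_div_le_add_log hlam.le
  norm_num at this ⊢
  linarith
end
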